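/- arXiv:0910.2608 — 3 statements merged into one kernel-verified Lean document; each statement's English description precedes it below -/
import Mathlib

section
/- For all integers ℓ ≥ h ≥ 0 and every point (i,j) with i > j ≥ 0, the number of pairs (w, S), where w is a B_{W2}-walk of length 2ℓ ending at (i,j) and S is an h-element subset of {1,…,ℓ} such that for every q ∈ S the step w_{2q−1} − w_{2q−2} equals (1,0) and the step w_{2q} − w_{2q−1} equals (−1,0), equals C(ℓ,h) · σ^{i,j}_{2(ℓ−h)}, where C(ℓ,h) is the binomial coefficient. -/
/-- The quarter plane `Q₂ = {(a,b) : a ≥ 0, b ≥ 0}`. -/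
def Q2 : Set (ℤ × ℤ) := {p | 0 ≤ p.1 ∧ 0 ≤ p.2}

/-- The Weyl chamber `W₂ = {(a,b) : a > b ≥ 0}`. -/
def W2 : Set (ℤ × ℤ) := {p | p.2 < p.1 ∧ 0 ≤ p.2}

/-- A "down" step: `(-1,0)`, `(0,-1)` or `(0,0)`. -/
def DownStep (d : ℤ × ℤ) : Prop := d = (-1, 0) ∨ d = (0, -1) ∨ d = (0, 0)

/-- An "up" step: `(1,0)`, `(0,1)` or `(0,0)`. -/
def UpStep (d : ℤ × ℤ) : Prop := d = (1, 0) ∨ d = (0, 1) ∨ d = (0, 0)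

/-- A `𝒫_D`-walk of length `s`: starts at `(1,0)`, stays in `D`, odd steps are
down steps, even steps are up steps.  (The walk is encoded as a function
`ℕ → ℤ × ℤ` which is constant from index `s` on.) -/
def IsPWalk (D : Set (ℤ × ℤ)) (s : ℕ) (w : ℕ → ℤ × ℤ) : Prop :=
  w 0 = (1, 0) ∧ (∀ r ≤ s, w r ∈ D) ∧
  (∀ r, 1 ≤ r → r ≤ s → r % 2 = 1 → DownStep (w r - w (r - 1))) ∧
  (∀ r, 1 ≤ r → r ≤ s → r % 2 = 0 → UpStep (w r - w (r - 1))) ∧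
  (∀ r, s ≤ r → w r = w s)

/-- A `ℬ_D`-walk of length `s`: starts at `(1,0)`, stays in `D`, odd steps are
up steps, even steps are down steps. -/
def IsBWalk (D : Set (ℤ × ℤ)) (s : ℕ) (w : ℕ → ℤ × ℤ) : Prop :=
  w 0 = (1, 0) ∧ (∀ r ≤ s, w r ∈ D) ∧
  (∀ r, 1 ≤ r → r ≤ s → r % 2 = 1 → UpStep (w r - w (r - 1))) ∧
  (∀ r, 1 ≤ r → r ≤ s → r % 2 = 0 → DownStep (w r - w (r - 1))) ∧
  (∀ r, s ≤ r → w r = w s)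

/-- `a^{i,j}_s`: the number of `𝒫_{Q₂}`-walks of length `s` ending at `p`. -/
noncomputable def aQ (s : ℕ) (p : ℤ × ℤ) : ℕ :=
  Nat.card {w : ℕ → ℤ × ℤ // IsPWalk Q2 s w ∧ w s = p}

/-- `ω^{i,j}_s`: the number of `𝒫_{W₂}`-walks of length `s` ending at `p`. -/
noncomputable def omegaW (s : ℕ) (p : ℤ × ℤ) : ℕ :=
  Nat.card {w : ℕ → ℤ × ℤ // IsPWalk W2 s w ∧ w s = p}

/-- `σ^{i,j}_s`: the number of `ℬ_{W₂}`-walks of length `s` ending at `p`. -/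
noncomputable def sigmaB (s : ℕ) (p : ℤ × ℤ) : ℕ :=
  Nat.card {w : ℕ → ℤ × ℤ // IsBWalk W2 s w ∧ w s = p}

/-- No index `q ≥ 1` with steps `w_{2q-1} - w_{2q-2} = (1,0)` and
`w_{2q} - w_{2q-1} = (-1,0)`. -/
def NoUpDownPair (s : ℕ) (w : ℕ → ℤ × ℤ) : Prop :=
  ∀ q, 1 ≤ q → 2 * q ≤ s →
    ¬ (w (2 * q - 1) - w (2 * q - 2) = (1, 0) ∧ w (2 * q) - w (2 * q - 1) = (-1, 0))

/-- A `ℬ*_{W₂}`-walk. -/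
def IsBStarWalk (s : ℕ) (w : ℕ → ℤ × ℤ) : Prop :=
  IsBWalk W2 s w ∧ NoUpDownPair s w

/-- `σ*^{i,j}_s`: the number of `ℬ*_{W₂}`-walks of length `s` ending at `p`. -/
noncomputable def sigmaStar (s : ℕ) (p : ℤ × ℤ) : ℕ :=
  Nat.card {w : ℕ → ℤ × ℤ // IsBStarWalk s w ∧ w s = p}

/-- The steps number `2q-1` and `2q` of `w` are `(1,0)` and `(-1,0)`. -/
def UpDownAt (w : ℕ → ℤ × ℤ) (q : ℕ) : Prop :=
  w (2 * q - 1) - w (2 * q - 2) = (1, 0) ∧ w (2 * q) - w (2 * q - 1) = (-1, 0)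

/-- The `ℬ_{W₂}`-walks of length `2ℓ` ending at `p` that have an up-down pair at each
`q ∈ S` with `1 ≤ q ≤ ℓ`. -/
abbrev MarkedWalk (S : Finset ℕ) (ℓ : ℕ) (p : ℤ × ℤ) : Type :=
  {w : ℕ → ℤ × ℤ // (IsBWalk W2 (2 * ℓ) w ∧ w (2 * ℓ) = p) ∧
    ∀ q ∈ S, 1 ≤ q → q ≤ ℓ → UpDownAt w q}

/-- The pairs `(a, b)` such that `a → b → p` is an up step followed by a down step inside `W₂`,
these two steps being `(1,0)` and `(-1,0)` if `P` holds. -/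
abbrev PenultimatePair (P : Prop) (p : ℤ × ℤ) : Type :=
  {c : (ℤ × ℤ) × (ℤ × ℤ) // (c.1 ∈ W2 ∧ c.2 ∈ W2 ∧ UpStep (c.2 - c.1) ∧ DownStep (p - c.2)) ∧
    (P → c.2 - c.1 = (1, 0) ∧ p - c.2 = (-1, 0))}

/-- The walk that follows `w` for `2ℓ` steps, then visits `b`, and then stays at `p`. -/
def extendWalk (ℓ : ℕ) (w : ℕ → ℤ × ℤ) (b p : ℤ × ℤ) (r : ℕ) : ℤ × ℤ :=
  if r ≤ 2 * ℓ then w r else if r = 2 * ℓ + 1 then b else p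

lemma extendWalk_of_le {ℓ r : ℕ} (w : ℕ → ℤ × ℤ) (b p : ℤ × ℤ) (hr : r ≤ 2 * ℓ) :
    extendWalk ℓ w b p r = w r := if_pos hr

lemma extendWalk_succ (ℓ : ℕ) (w : ℕ → ℤ × ℤ) (b p : ℤ × ℤ) :
    extendWalk ℓ w b p (2 * ℓ + 1) = b := by
  simp [extendWalk]

lemma extendWalk_of_lt {ℓ r : ℕ} (w : ℕ → ℤ × ℤ) (b p : ℤ × ℤ) (hr : 2 * ℓ + 1 < r) :
    extendWalk ℓ w b p r = p := by
  rw [extendWalk, if_neg (by omega), if_neg (by omega)]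

lemma IsBWalk.extendWalk {ℓ : ℕ} {w : ℕ → ℤ × ℤ} {b p : ℤ × ℤ} (hw : IsBWalk W2 (2 * ℓ) w)
    (hp : p ∈ W2) (hb : b ∈ W2) (hup : UpStep (b - w (2 * ℓ))) (hdown : DownStep (p - b)) :
    IsBWalk W2 (2 * (ℓ + 1)) (extendWalk ℓ w b p) := by
  obtain ⟨h0, hD, hodd, heven, -⟩ := hw
  refine ⟨?_, fun r hr => ?_, fun r h1 hr hm => ?_, fun r h1 hr hm => ?_, fun r hr => ?_⟩
  · rwa [extendWalk_of_le _ _ _ (Nat.zero_le _)]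
  · unfold _root_.extendWalk
    split_ifs with h
    exacts [hD r h, hb, hp]
  · rcases lt_or_ge (2 * ℓ) r with h | h
    · obtain rfl : r = 2 * ℓ + 1 := by omega
      rwa [extendWalk_succ, extendWalk_of_le _ _ _ (by omega), Nat.add_sub_cancel]
    · rw [extendWalk_of_le _ _ _ h, extendWalk_of_le _ _ _ (by omega)]
      exact hodd r h1 h hm
  · rcases lt_or_ge (2 * ℓ) r with h | h
    · obtain rfl : r = 2 * ℓ + 1 + 1 := by omega
      rwa [extendWalk_of_lt _ _ _ (by omega), Nat.add_sub_cancel, extendWalk_succ]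
    · rw [extendWalk_of_le _ _ _ h, extendWalk_of_le _ _ _ (by omega)]
      exact heven r h1 h hm
  · rw [extendWalk_of_lt _ _ _ (by omega), extendWalk_of_lt _ _ _ (by omega)]

lemma IsBWalk.truncate {D : Set (ℤ × ℤ)} {s t : ℕ} {w : ℕ → ℤ × ℤ} (hw : IsBWalk D s w)
    (hts : t ≤ s) : IsBWalk D t (fun r => w (min r t)) := by
  obtain ⟨h0, hD, hodd, heven, -⟩ := hw
  refine ⟨by simpa using h0, fun r hr => hD _ (by omega), fun r h1 hr hm => ?_,
    fun r h1 hr hm => ?_, fun r hr => by simp [hr]⟩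
  · simpa [hr, (Nat.sub_le r 1).trans hr] using hodd r h1 (by omega) hm
  · simpa [hr, (Nat.sub_le r 1).trans hr] using heven r h1 (by omega) hm

lemma UpDownAt.congr {w v : ℕ → ℤ × ℤ} {q : ℕ} (hw : UpDownAt w q)
    (h : ∀ r ≤ 2 * q, w r = v r) : UpDownAt v q := by
  rwa [UpDownAt, ← h _ le_rfl, ← h _ (Nat.sub_le _ _), ← h _ (Nat.sub_le _ _)]

lemma upDownAt_succ (w : ℕ → ℤ × ℤ) (ℓ : ℕ) :
    UpDownAt w (ℓ + 1) ↔
      w (2 * ℓ + 1) - w (2 * ℓ) = (1, 0) ∧ w (2 * (ℓ + 1)) - w (2 * ℓ + 1) = (-1, 0) :=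
  Iff.rfl

/-- Extension of a marked walk of length `2ℓ` by two further steps. -/
def MarkedWalk.extend {S : Finset ℕ} {ℓ : ℕ} {p : ℤ × ℤ} (hp : p ∈ W2)
    (x : Σ c : PenultimatePair (ℓ + 1 ∈ S) p, MarkedWalk S ℓ c.1.1) : MarkedWalk S (ℓ + 1) p :=
  ⟨extendWalk ℓ x.2.1 x.1.1.2 p, by
    obtain ⟨⟨⟨a, b⟩, ⟨ha, hb, hup, hdown⟩, hS⟩, w, ⟨hw, hwa⟩, hwS⟩ := x
    obtain rfl : w (2 * ℓ) = a := hwa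
    refine ⟨⟨hw.extendWalk hp hb hup hdown, extendWalk_of_lt _ _ _ (by omega)⟩,
      fun q hq h1 hqℓ => ?_⟩
    rcases Nat.lt_or_ge ℓ q with h | h
    · obtain rfl : q = ℓ + 1 := by omega
      rw [upDownAt_succ, extendWalk_succ, extendWalk_of_le _ _ _ le_rfl,
        extendWalk_of_lt _ _ _ (by omega)]
      exact hS hq
    · exact (hwS q hq h1 h).congr fun r hr => (extendWalk_of_le _ _ _ (by omega)).symm⟩

lemma MarkedWalk.extend_bijective {S : Finset ℕ} {ℓ : ℕ} {p : ℤ × ℤ} (hp : p ∈ W2) :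
    Function.Bijective (MarkedWalk.extend (S := S) (ℓ := ℓ) hp) := by
  constructor
  · rintro ⟨⟨⟨a, b⟩, hc⟩, w, ⟨hw, hwa⟩, hwS⟩ ⟨⟨⟨a', b'⟩, hc'⟩, w', ⟨hw', hwa'⟩, hwS'⟩ h
    obtain rfl : w (2 * ℓ) = a := hwa
    obtain rfl : w' (2 * ℓ) = a' := hwa'
    have key : extendWalk ℓ w b p = extendWalk ℓ w' b' p := congrArg Subtype.val h
    obtain rfl : b = b' := by simpa [extendWalk_succ] using congrFun key (2 * ℓ + 1)
    have hle : ∀ r ≤ 2 * ℓ, w r = w' r := fun r hr => by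
      simpa [extendWalk_of_le _ _ _ hr] using congrFun key r
    obtain rfl : w = w' := by
      funext r
      rcases le_total r (2 * ℓ) with hr | hr
      · exact hle r hr
      · rw [hw.2.2.2.2 r hr, hw'.2.2.2.2 r hr, hle _ le_rfl]
    rfl
  · rintro ⟨w, ⟨hw, rfl⟩, hwS⟩
    refine ⟨⟨⟨(w (2 * ℓ), w (2 * ℓ + 1)), ⟨hw.2.1 _ (by omega), hw.2.1 _ (by omega),
      hw.2.2.1 (2 * ℓ + 1) (by omega) (by omega) (by omega),
      hw.2.2.2.1 (2 * (ℓ + 1)) (by omega) le_rfl (by omega)⟩,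
      fun h => hwS _ h (by omega) le_rfl⟩,
      ⟨fun r => w (min r (2 * ℓ)), ⟨hw.truncate (by omega), by simp⟩, fun q hq h1 hqℓ =>
        (hwS q hq h1 (by omega)).congr fun r hr => by rw [min_eq_left (by omega)]⟩⟩,
      Subtype.ext (funext fun r => ?_)⟩
    change extendWalk ℓ (fun r => w (min r (2 * ℓ))) (w (2 * ℓ + 1)) (w (2 * (ℓ + 1))) r = w r
    unfold extendWalk
    split_ifs with h h'
    · exact congrArg w (min_eq_left h)
    · rw [h']
    · exact (hw.2.2.2.2 r (by omega)).symm

/-- A marked walk of length `2(ℓ+1)` is a marked walk of length `2ℓ` followed by two steps. -/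
noncomputable def MarkedWalk.extendEquiv (S : Finset ℕ) (ℓ : ℕ) {p : ℤ × ℤ} (hp : p ∈ W2) :
    (Σ c : PenultimatePair (ℓ + 1 ∈ S) p, MarkedWalk S ℓ c.1.1) ≃ MarkedWalk S (ℓ + 1) p :=
  Equiv.ofBijective _ (MarkedWalk.extend_bijective hp)

/-- The only up-down pair ending at `p` is `p → p + (1,0) → p`. -/
abbrev PenultimatePair.unique {P : Prop} (hP : P) {p : ℤ × ℤ} (hp : p ∈ W2) :
    Unique (PenultimatePair P p) where
  default := ⟨(p, p + (1, 0)), by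
    obtain ⟨a, b⟩ := p
    simp only [W2, Set.mem_ofPred_eq] at hp
    simp [W2, UpStep, DownStep]
    omega⟩
  uniq := by
    rintro ⟨⟨a, b⟩, -, h⟩
    obtain ⟨h1, h2⟩ := h hP
    obtain rfl : b = p + (1, 0) := by
      rw [← sub_sub_cancel p b, h2]
      simp [sub_eq_add_neg]
    obtain rfl : a = p := by
      rw [← sub_sub_cancel (p + (1, 0)) a, h1, add_sub_cancel_right]
    rfl

/-- Deleting the marked up-down pairs of a walk. -/
lemma MarkedWalk.nonempty_equiv_empty (S : Finset ℕ) (ℓ m : ℕ) (p : ℤ × ℤ) (hp : p ∈ W2)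
    (hm : m + (S ∩ Finset.Icc 1 ℓ).card = ℓ) :
    Nonempty (MarkedWalk S ℓ p ≃ MarkedWalk ∅ m p) := by
  induction ℓ generalizing m p with
  | zero =>
    obtain rfl : m = 0 := by omega
    exact ⟨Equiv.subtypeEquivRight fun w => and_congr_right fun _ => by
      simp only [Finset.notMem_empty, false_implies, implies_true, iff_true]
      intro q _ h1 h0
      omega⟩
  | succ ℓ ih =>
    rw [← Finset.insert_Icc_right_eq_Icc_add_one (by omega)] at hm
    by_cases hS : ℓ + 1 ∈ S
    · rw [Finset.inter_insert_of_mem hS, Finset.card_insert_of_notMem (by simp)] at hm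
      obtain ⟨e⟩ := ih m p hp (by omega)
      let := PenultimatePair.unique hS hp
      exact ⟨((extendEquiv S ℓ hp).symm.trans (Equiv.uniqueSigma _)).trans e⟩
    · rw [Finset.inter_insert_of_notMem hS] at hm
      have hcard : (S ∩ Finset.Icc 1 ℓ).card ≤ ℓ := by
        simpa using Finset.card_le_card (Finset.inter_subset_right (s₁ := S) (s₂ := Finset.Icc 1 ℓ))
      obtain ⟨m, rfl⟩ : ∃ k, m = k + 1 := ⟨m - 1, by omega⟩
      have e (c : PenultimatePair (ℓ + 1 ∈ S) p) :
          Nonempty (MarkedWalk S ℓ c.1.1 ≃ MarkedWalk ∅ m c.1.1) :=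
        ih m c.1.1 c.2.1.1 (by omega)
      have hiff : ℓ + 1 ∈ S ↔ m + 1 ∈ (∅ : Finset ℕ) := by simp [hS]
      let f : PenultimatePair (ℓ + 1 ∈ S) p ≃ PenultimatePair (m + 1 ∈ (∅ : Finset ℕ)) p :=
        Equiv.subtypeEquivRight fun c => by rw [hiff]
      exact ⟨((extendEquiv S ℓ hp).symm.trans
        (Equiv.sigmaCongr f fun c => (e c).some)).trans (extendEquiv ∅ m hp)⟩

lemma card_markedWalk_empty (m : ℕ) (p : ℤ × ℤ) :
    Nat.card (MarkedWalk ∅ m p) = sigmaB (2 * m) p :=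
  Nat.card_congr (Equiv.subtypeEquivRight fun w => by simp)

/-- Pairs of a walk and a set of marks, fibred over the set of marks. -/
def markedPairsEquiv (ℓ h : ℕ) (p : ℤ × ℤ) :
    {ws : (ℕ → ℤ × ℤ) × Finset ℕ //
        IsBWalk W2 (2 * ℓ) ws.1 ∧ ws.1 (2 * ℓ) = p ∧
        ws.2 ⊆ Finset.Icc 1 ℓ ∧ ws.2.card = h ∧ ∀ q ∈ ws.2, UpDownAt ws.1 q} ≃
      Σ S : (Finset.Icc 1 ℓ).powersetCard h, MarkedWalk S.1 ℓ p where
  toFun x := ⟨⟨x.1.2, Finset.mem_powersetCard.2 ⟨x.2.2.2.1, x.2.2.2.2.1⟩⟩,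
    ⟨x.1.1, ⟨x.2.1, x.2.2.1⟩, fun q hq _ _ => x.2.2.2.2.2 q hq⟩⟩
  invFun y := ⟨(y.2.1, y.1.1), y.2.2.1.1, y.2.2.1.2, (Finset.mem_powersetCard.1 y.1.2).1,
    (Finset.mem_powersetCard.1 y.1.2).2, fun q hq =>
      have hq' := Finset.mem_Icc.1 ((Finset.mem_powersetCard.1 y.1.2).1 hq)
      y.2.2.2 q hq hq'.1 hq'.2⟩
  left_inv _ := rfl
  right_inv _ := rfl

/-- For `ℓ ≥ h ≥ 0` and `i > j ≥ 0`, the number of pairs `(w, S)` where `w` is a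
`ℬ_{W₂}`-walk of length `2ℓ` ending at `(i,j)` and `S` is an `h`-element subset of
`{1,…,ℓ}` such that for each `q ∈ S` the steps number `2q-1` and `2q` of `w` are
`(1,0)` and `(-1,0)`, equals `C(ℓ,h)·σ^{i,j}_{2(ℓ-h)}`. -/
theorem marked_walk_count (ℓ h : ℕ) (hh : h ≤ ℓ) (i j : ℤ) (hij : j < i) (hj : 0 ≤ j) :
    Nat.card {ws : (ℕ → ℤ × ℤ) × Finset ℕ //
        IsBWalk W2 (2 * ℓ) ws.1 ∧ ws.1 (2 * ℓ) = (i, j) ∧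
        ws.2 ⊆ Finset.Icc 1 ℓ ∧ ws.2.card = h ∧
        ∀ q ∈ ws.2, ws.1 (2 * q - 1) - ws.1 (2 * q - 2) = (1, 0)
          ∧ ws.1 (2 * q) - ws.1 (2 * q - 1) = (-1, 0)}
      = Nat.choose ℓ h * sigmaB (2 * (ℓ - h)) (i, j) := by
  have e (S : (Finset.Icc 1 ℓ).powersetCard h) :
      Nonempty (MarkedWalk S.1 ℓ (i, j) ≃ MarkedWalk ∅ (ℓ - h) (i, j)) := by
    obtain ⟨hS, hcard⟩ := Finset.mem_powersetCard.1 S.2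
    refine MarkedWalk.nonempty_equiv_empty S.1 ℓ (ℓ - h) (i, j) ⟨hij, hj⟩ ?_
    rw [Finset.inter_eq_left.2 hS, hcard]
    omega
  refine (Nat.card_congr ((markedPairsEquiv ℓ h (i, j)).trans
    ((Equiv.sigmaCongrRight fun S => (e S).some).trans (Equiv.sigmaEquivProd _ _)))).trans ?_
  rw [Nat.card_prod, card_markedWalk_empty, Nat.card_eq_fintype_card, Fintype.card_coe,
    Finset.card_powersetCard, Nat.card_Icc, Nat.add_sub_cancel]
end

section
/- For every integer N ≥ 2, the number of 2-regular, 3-noncrossing set partitions of [N] equals σ*^{1,0}_{2N−2}, the number of B*_{W2}-walks of length 2N−2 ending at (1,0). -/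
/-- `i` and `j` lie in a common block of the partition `P`. -/
def SameBlock {N : ℕ} (P : Finpartition (Finset.univ : Finset (Fin N))) (i j : Fin N) : Prop :=
  ∃ B ∈ P.parts, i ∈ B ∧ j ∈ B

/-- `(i,j)` is an arc of the standard representation of the partition `P`:
`i < j` lie in a common block with no element of that block strictly between them. -/
def IsArc {N : ℕ} (P : Finpartition (Finset.univ : Finset (Fin N))) (i j : Fin N) : Prop :=
  i < j ∧ SameBlock P i j ∧ ∀ l : Fin N, i < l → l < j → ¬ SameBlock P i l

/-- The partition `P` has a `k`-crossing: arcs `(i₁,j₁),…,(i_k,j_k)` with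
`i₁ < … < i_k < j₁ < … < j_k`. -/
def PartitionHasKCrossing {N : ℕ} (k : ℕ)
    (P : Finpartition (Finset.univ : Finset (Fin N))) : Prop :=
  ∃ a b : Fin k → Fin N, StrictMono a ∧ StrictMono b ∧
    (∀ m, IsArc P (a m) (b m)) ∧ ∀ m m', a m < b m'

/-- A `k`-noncrossing set partition. -/
def IsKNoncrossingPartition {N : ℕ} (k : ℕ)
    (P : Finpartition (Finset.univ : Finset (Fin N))) : Prop :=
  ¬ PartitionHasKCrossing k P

/-- A `2`-regular partition: distinct elements of a common block differ by at least `2`. -/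
def IsTwoRegular {N : ℕ} (P : Finpartition (Finset.univ : Finset (Fin N))) : Prop :=
  ∀ i j : Fin N, SameBlock P i j → i ≠ j → 2 ≤ |(i : ℤ) - (j : ℤ)|

/-- A braid over `[M]`, given as its finite set of arcs `(i,j)` with `i ≤ j`:
every vertex is the smaller endpoint of at most one arc and the larger endpoint
of at most one arc. -/
def IsBraid {M : ℕ} (B : Finset (Fin M × Fin M)) : Prop :=
  (∀ p ∈ B, p.1 ≤ p.2) ∧
  (∀ p ∈ B, ∀ q ∈ B, p.1 = q.1 → p = q) ∧
  (∀ p ∈ B, ∀ q ∈ B, p.2 = q.2 → p = q)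

/-- The braid `B` has a `k`-crossing: arcs `(i₁,j₁),…,(i_k,j_k)` with
`i₁ < … < i_k ≤ j₁ < … < j_k`. -/
def BraidHasKCrossing {M : ℕ} (k : ℕ) (B : Finset (Fin M × Fin M)) : Prop :=
  ∃ a b : Fin k → Fin M, StrictMono a ∧ StrictMono b ∧
    (∀ m, (a m, b m) ∈ B) ∧ ∀ m m', a m ≤ b m'

/-- A `k`-noncrossing braid. -/
def IsKNoncrossingBraid {M : ℕ} (k : ℕ) (B : Finset (Fin M × Fin M)) : Prop :=
  IsBraid B ∧ ¬ BraidHasKCrossing k B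

/-- The braid `B` contains a loop `(i,i)`. -/
def HasLoop {M : ℕ} (B : Finset (Fin M × Fin M)) : Prop := ∃ i, (i, i) ∈ B

section Tableaux

/-- A tableau with at most two rows, given by the sets of entries of its rows. -/
abbrev Tab : Type := Finset ℕ × Finset ℕ

/-- Row insertion of `x` ending in the first row (for the reversed order on `ℕ`). -/
def InsertFirst (x : ℕ) (T T' : Tab) : Prop :=
  (∀ r ∈ T.1, x < r) ∧ x ∉ T.2 ∧ T' = (insert x T.1, T.2)

/-- Row insertion of `x` that bumps an entry `y` of the first row to the end of the
second row (for the reversed order on `ℕ`). -/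
def InsertSecond (x : ℕ) (T T' : Tab) : Prop :=
  ∃ y ∈ T.1, y < x ∧ x ∉ T.1 ∧ x ∉ T.2 ∧ (∀ r ∈ T.1, r < x → r ≤ y) ∧
    (∀ s ∈ T.2, y < s) ∧ T' = (insert x (T.1.erase y), insert y T.2)

/-- Row insertion of `x` producing at most two rows. -/
def RowInsert (x : ℕ) (T T' : Tab) : Prop := InsertFirst x T T' ∨ InsertSecond x T T'

/-- The tableau is standard for the reversed order on `ℕ`: the rows are disjoint and
satisfy the ballot condition. -/
def IsStd (T : Tab) : Prop :=
  Disjoint T.1 T.2 ∧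
    ∀ k, (T.2.filter (k ≤ ·)).card ≤ (T.1.filter (k ≤ ·)).card

/-- The shape of a tableau as a point of the Weyl chamber. -/
def shape (T : Tab) : ℤ × ℤ := ((T.1.card : ℤ) + 1, (T.2.card : ℤ))

/-- Deletion of an entry. -/
def delete (x : ℕ) (T : Tab) : Tab := (T.1.erase x, T.2.erase x)

theorem card_filter_le_insert {R : Finset ℕ} {x : ℕ} (h : x ∉ R) (k : ℕ) :
    ((insert x R).filter (k ≤ ·)).card
      = (R.filter (k ≤ ·)).card + if k ≤ x then 1 else 0 := by
  rw [Finset.filter_insert]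
  split_ifs
  · rw [Finset.card_insert_of_notMem (by simp [h])]
  · rfl

theorem card_filter_le_erase {R : Finset ℕ} {x : ℕ} (h : x ∈ R) (k : ℕ) :
    ((R.erase x).filter (k ≤ ·)).card + (if k ≤ x then 1 else 0)
      = (R.filter (k ≤ ·)).card := by
  conv_rhs => rw [← Finset.insert_erase h]
  rw [card_filter_le_insert (Finset.notMem_erase x R)]

theorem card_filter_le_of_forall_le {R : Finset ℕ} {k : ℕ} (h : ∀ r ∈ R, k ≤ r) :
    (R.filter (k ≤ ·)).card = R.card := by
  rw [Finset.filter_true_of_mem h]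

theorem IsStd.card_le {T : Tab} (h : IsStd T) : T.2.card ≤ T.1.card := by
  simpa using h.2 0

theorem IsStd.shape_mem {T : Tab} (h : IsStd T) : shape T ∈ W2 := by
  have := h.card_le
  simp only [W2, shape, Set.mem_ofPred_eq]
  omega

theorem isStd_empty : IsStd (∅, ∅) := by simp [IsStd]

theorem eq_empty_of_shape_eq {T : Tab} (h : shape T = (1, 0)) : T = (∅, ∅) := by
  simp only [shape, Prod.mk.injEq] at h
  exact Prod.ext (Finset.card_eq_zero.1 (by omega)) (Finset.card_eq_zero.1 (by omega))

theorem RowInsert.mem_iff {x : ℕ} {T T' : Tab} (h : RowInsert x T T') (z : ℕ) :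
    (z ∈ T'.1 ∨ z ∈ T'.2) ↔ z = x ∨ z ∈ T.1 ∨ z ∈ T.2 := by
  rcases h with ⟨-, -, rfl⟩ | ⟨y, hy, -, -, -, -, -, rfl⟩ <;> grind

theorem RowInsert.notMem {x : ℕ} {T T' : Tab} (h : RowInsert x T T') :
    x ∉ T.1 ∧ x ∉ T.2 := by
  rcases h with ⟨h, h', -⟩ | ⟨y, -, -, h, h', -⟩ <;> grind

theorem InsertFirst.shape_sub {x : ℕ} {T T' : Tab} (h : InsertFirst x T T') :
    shape T' - shape T = (1, 0) := by
  obtain ⟨h, -, rfl⟩ := h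
  simp [shape, Finset.card_insert_of_notMem (fun hx => lt_irrefl _ (h x hx))]

theorem InsertSecond.shape_sub {x : ℕ} {T T' : Tab} (hT : IsStd T)
    (h : InsertSecond x T T') : shape T' - shape T = (0, 1) := by
  obtain ⟨y, hy, -, hx, -, -, -, rfl⟩ := h
  have h1 : y ∉ T.2 := Finset.disjoint_left.1 hT.1 hy
  have h2 : x ∉ T.1.erase y := fun h => hx (Finset.mem_of_mem_erase h)
  simp [shape, Finset.card_insert_of_notMem h1, Finset.card_insert_of_notMem h2,
    Finset.card_erase_add_one hy]

theorem RowInsert.isStd {x : ℕ} {T T' : Tab} (h : RowInsert x T T') (hT : IsStd T) :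
    IsStd T' := by
  rcases h with ⟨hx, hx2, rfl⟩ | ⟨y, hy, hyx, hx1, hx2, hmax, hs, rfl⟩
  · have hx1 : x ∉ T.1 := fun h => lt_irrefl _ (hx x h)
    refine ⟨by simp [hT.1, hx2], fun k => ?_⟩
    have := hT.2 k
    rw [card_filter_le_insert hx1]
    dsimp only
    omega
  · have hy2 : y ∉ T.2 := Finset.disjoint_left.1 hT.1 hy
    have hx1' : x ∉ T.1.erase y := fun h => hx1 (Finset.mem_of_mem_erase h)
    refine ⟨?_, fun k => ?_⟩
    · have := Finset.disjoint_left.1 hT.1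
      rw [Finset.disjoint_left]
      grind
    · dsimp only
      rw [card_filter_le_insert hx1', card_filter_le_insert hy2]
      have h1 := card_filter_le_erase hy k
      have h2 := hT.2 k
      by_cases hk : k ≤ y
      · simp only [hk, if_true, (by omega : k ≤ x)] at h1 ⊢
        have h3 : (T.2.filter (k ≤ ·)).card = (T.2.filter (y + 1 ≤ ·)).card := by
          congr 1
          ext s
          grind
        have h4 := hT.2 (y + 1)
        have h5 := card_filter_le_erase hy (y + 1)
        have h6 : ((T.1.erase y).filter (y + 1 ≤ ·)).card
            ≤ ((T.1.erase y).filter (k ≤ ·)).card := by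
          apply Finset.card_le_card
          intro s
          grind
        have h7 : ¬ (y + 1 ≤ y) := by omega
        simp only [h7, if_false] at h5
        omega
      · simp only [hk, if_false] at h1 ⊢
        omega

theorem RowInsert.unique_right {x : ℕ} {T T₁ T₂ : Tab} (h₁ : RowInsert x T T₁)
    (h₂ : RowInsert x T T₂) : T₁ = T₂ := by
  rcases h₁ with ⟨hx, hx2, rfl⟩ | ⟨y, hy, hyx, hx1, hx2, hmax, hs, rfl⟩ <;>
  rcases h₂ with ⟨hx', hx2', rfl⟩ | ⟨y', hy', hyx', hx1', hx2', hmax', hs', rfl⟩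
  · rfl
  · grind
  · grind
  · obtain rfl : y = y' := le_antisymm (hmax' y hy hyx) (hmax y' hy' hyx')
    rfl

theorem InsertFirst.unique_left {x x' : ℕ} {T₁ T₂ T : Tab} (h₁ : InsertFirst x T₁ T)
    (h₂ : InsertFirst x' T₂ T) : x = x' ∧ T₁ = T₂ := by
  obtain ⟨h1, -, rfl⟩ := h₁
  obtain ⟨h2, -, h⟩ := h₂
  simp only [Prod.mk.injEq] at h
  have e : x = x' := by
    have := h.1 ▸ Finset.mem_insert_self x T₁.1
    have := h.1 ▸ Finset.mem_insert_self x' T₂.1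
    grind
  subst e
  refine ⟨rfl, Prod.ext ?_ h.2⟩
  rw [← Finset.erase_insert (fun hx => lt_irrefl _ (h1 x hx)), h.1,
    Finset.erase_insert (fun hx => lt_irrefl _ (h2 x hx))]

theorem InsertSecond.unique_left {x x' : ℕ} {T₁ T₂ T : Tab} (hT₁ : IsStd T₁) (hT₂ : IsStd T₂)
    (h₁ : InsertSecond x T₁ T) (h₂ : InsertSecond x' T₂ T) : x = x' ∧ T₁ = T₂ := by
  obtain ⟨y, hy, hyx, hx1, hx2, hmax, hs, rfl⟩ := h₁
  obtain ⟨y', hy', hyx', hx1', hx2', hmax', hs', h⟩ := h₂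
  simp only [Prod.mk.injEq] at h
  obtain ⟨ha, hb⟩ := h
  have hy2 : y ∉ T₁.2 := Finset.disjoint_left.1 hT₁.1 hy
  have hy2' : y' ∉ T₂.2 := Finset.disjoint_left.1 hT₂.1 hy'
  have e : y = y' := by
    have := hb ▸ Finset.mem_insert_self y T₁.2
    have := hb ▸ Finset.mem_insert_self y' T₂.2
    grind
  subst e
  have e : x = x' := by
    have := ha ▸ Finset.mem_insert_self x (T₁.1.erase y)
    have := ha ▸ Finset.mem_insert_self x' (T₂.1.erase y)
    grind
  subst e
  refine ⟨rfl, Prod.ext ?_ ?_⟩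
  · have e1 : x ∉ T₁.1.erase y := by grind
    have e2 : x ∉ T₂.1.erase y := by grind
    rw [← Finset.insert_erase hy, ← Finset.insert_erase hy', ← Finset.erase_insert e1,
      ha, Finset.erase_insert e2]
  · rw [← Finset.erase_insert hy2, hb, Finset.erase_insert hy2']

theorem IsStd.delete {x : ℕ} {T : Tab} (hT : IsStd T) (h₁ : ∀ r ∈ T.1, x ≤ r)
    (h₂ : ∀ r ∈ T.2, x ≤ r) : IsStd (delete x T) := by
  refine ⟨hT.1.mono (Finset.erase_subset _ _) (Finset.erase_subset _ _), fun k => ?_⟩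
  by_cases hk : k ≤ x
  · have e : ((T.1.erase x).filter (x + 1 ≤ ·)).card = ((T.1.erase x).filter (k ≤ ·)).card := by
      congr 1
      ext
      grind
    have e' : ((T.2.erase x).filter (x + 1 ≤ ·)).card = ((T.2.erase x).filter (k ≤ ·)).card := by
      congr 1
      ext
      grind
    have e1 : (T.1.erase x).filter (x + 1 ≤ ·) = T.1.filter (x + 1 ≤ ·) := by
      ext
      grind
    have e2 : (T.2.erase x).filter (x + 1 ≤ ·) = T.2.filter (x + 1 ≤ ·) := by
      ext
      grind
    have := hT.2 (x + 1)
    simp only [_root_.delete]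
    rw [← e, ← e', e1, e2]
    exact this
  · have e1 : (T.1.erase x).filter (k ≤ ·) = T.1.filter (k ≤ ·) := by
      ext
      grind
    have e2 : (T.2.erase x).filter (k ≤ ·) = T.2.filter (k ≤ ·) := by
      ext
      grind
    simp only [_root_.delete]
    rw [e1, e2]
    exact hT.2 k

theorem shape_delete {T : Tab} (hT : IsStd T) (x : ℕ) :
    (x ∈ T.1 ∧ shape (delete x T) - shape T = (-1, 0)) ∨
    (x ∈ T.2 ∧ shape (delete x T) - shape T = (0, -1)) ∨
    (x ∉ T.1 ∧ x ∉ T.2 ∧ shape (delete x T) - shape T = (0, 0)) := by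
  have hd := Finset.disjoint_left.1 hT.1
  by_cases h1 : x ∈ T.1
  · left
    have := Finset.card_erase_add_one h1
    simp only [h1, shape, delete, Finset.erase_eq_of_notMem (hd h1), Prod.mk_sub_mk,
      Prod.mk.injEq, true_and]
    omega
  · by_cases h2 : x ∈ T.2
    · right; left
      have := Finset.card_erase_add_one h2
      simp only [h2, shape, delete, Finset.erase_eq_of_notMem h1, Prod.mk_sub_mk,
        Prod.mk.injEq, true_and]
      omega
    · right; right
      simp only [h1, h2, delete, not_false_eq_true, Finset.erase_eq_of_notMem, sub_self,
        true_and]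
      rfl

theorem delete_unique {x : ℕ} {T₁ T₂ : Tab} (h₁ : IsStd T₁) (h₂ : IsStd T₂)
    (h : delete x T₁ = delete x T₂) (hs : shape T₁ = shape T₂) : T₁ = T₂ := by
  have a₁ := shape_delete h₁ x
  have a₂ := shape_delete h₂ x
  rw [h, hs] at a₁
  simp only [delete, Prod.mk.injEq] at h
  have hd₁ := Finset.disjoint_left.1 h₁.1
  have hd₂ := Finset.disjoint_left.1 h₂.1
  have key : (x ∈ T₁.1 ↔ x ∈ T₂.1) ∧ (x ∈ T₁.2 ↔ x ∈ T₂.2) := by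
    rcases a₁ with ⟨b₁, c₁⟩ | ⟨b₁, c₁⟩ | ⟨b₁, b₁', c₁⟩ <;> rw [c₁] at a₂ <;>
      simp at a₂ <;> grind
  have e1 := fun z => Finset.ext_iff.1 h.1 z
  have e2 := fun z => Finset.ext_iff.1 h.2 z
  simp only [Finset.mem_erase] at e1 e2
  ext z <;> by_cases hz : z = x <;> grind

theorem exists_reverse_delete {t : ℕ} {V : Tab} (hV : IsStd V)
    (hV1 : ∀ r ∈ V.1, t < r) (hV2 : ∀ r ∈ V.2, t < r) {p : ℤ × ℤ} (hp : p ∈ W2)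
    (hd : DownStep (shape V - p)) :
    ∃ U, IsStd U ∧ (∀ r ∈ U.1, t ≤ r) ∧ (∀ r ∈ U.2, t ≤ r) ∧ shape U = p ∧
      delete t U = V := by
  have ht1 : t ∉ V.1 := fun h => lt_irrefl _ (hV1 t h)
  have ht2 : t ∉ V.2 := fun h => lt_irrefl _ (hV2 t h)
  obtain ⟨p1, p2⟩ := p
  simp only [shape, DownStep, Prod.mk_sub_mk, Prod.mk.injEq, W2, Set.mem_ofPred_eq] at hd hp
  have hc := hV.card_le
  rcases hd with h | h | h
  · refine ⟨(insert t V.1, V.2), ⟨by simp [hV.1, ht2], fun k => ?_⟩, by grind, by grind, ?_, ?_⟩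
    · have := hV.2 k
      rw [card_filter_le_insert ht1]
      dsimp only
      omega
    · simp [shape, Finset.card_insert_of_notMem ht1]
      omega
    · simp [delete, ht1, ht2]
  · refine ⟨(V.1, insert t V.2), ⟨by simp [hV.1, ht1], fun k => ?_⟩, by grind, by grind, ?_, ?_⟩
    · have := hV.2 k
      rw [card_filter_le_insert ht2]
      dsimp only
      split_ifs with hk
      · rw [card_filter_le_of_forall_le fun r hr => hk.trans (hV1 r hr).le,
          card_filter_le_of_forall_le fun r hr => hk.trans (hV2 r hr).le]
        omega
      · omega
    · simp [shape, Finset.card_insert_of_notMem ht2]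
      omega
    · simp [delete, ht1, ht2]
  · refine ⟨V, hV, by grind, by grind, ?_, ?_⟩
    · simp [shape]
      omega
    · simp [delete, ht1, ht2]

theorem exists_reverse_insert {U : Tab} (hU : IsStd U) {p : ℤ × ℤ} (hp : p ∈ W2)
    (hu : UpStep (shape U - p)) :
    ∃ V, IsStd V ∧ shape V = p ∧ ((∃ x, RowInsert x V U) ∨ U = V) := by
  obtain ⟨p1, p2⟩ := p
  simp only [shape, UpStep, Prod.mk_sub_mk, Prod.mk.injEq, W2, Set.mem_ofPred_eq] at hu hp
  have hc := hU.card_le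
  rcases hu with h | h | h
  · have hne : U.1.Nonempty := Finset.card_pos.1 (by omega)
    obtain ⟨x, hx, hmin⟩ : ∃ x ∈ U.1, ∀ r ∈ U.1, x ≤ r :=
      ⟨_, Finset.min'_mem _ hne, fun r hr => Finset.min'_le _ r hr⟩
    have hx2 := Finset.disjoint_left.1 hU.1 hx
    have hcard := Finset.card_erase_add_one hx
    refine ⟨(U.1.erase x, U.2), ⟨hU.1.mono_left (Finset.erase_subset _ _), fun k => ?_⟩, ?_,
      .inl ⟨x, .inl ⟨by grind, hx2, ?_⟩⟩⟩
    · have h1 := card_filter_le_erase hx k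
      have h2 := hU.2 k
      dsimp only
      split_ifs at h1 with hk
      · have h3 : (U.1.filter (k ≤ ·)).card = U.1.card :=
          card_filter_le_of_forall_le fun r hr => hk.trans (hmin r hr)
        have h4 := Finset.card_filter_le U.2 (k ≤ ·)
        omega
      · omega
    · simp [shape]
      omega
    · simp [Finset.insert_erase hx]
  · have hne : U.2.Nonempty := Finset.card_pos.1 (by omega)
    obtain ⟨y, hy, hymin⟩ : ∃ y ∈ U.2, ∀ r ∈ U.2, y ≤ r :=
      ⟨_, Finset.min'_mem _ hne, fun r hr => Finset.min'_le _ r hr⟩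
    have hy1 : y ∉ U.1 := Finset.disjoint_right.1 hU.1 hy
    have hne' : (U.1.filter (y ≤ ·)).Nonempty := by
      apply Finset.card_pos.1
      refine lt_of_lt_of_le (Finset.card_pos.2 ⟨y, ?_⟩) (hU.2 y)
      simp [hy]
    obtain ⟨x, hx, hyx, hxmin⟩ : ∃ x ∈ U.1, y < x ∧ ∀ r ∈ U.1, y < r → x ≤ r := by
      obtain ⟨x, h1, h2⟩ : ∃ x ∈ U.1.filter (y ≤ ·), ∀ r ∈ U.1.filter (y ≤ ·), x ≤ r :=
        ⟨_, Finset.min'_mem _ hne', fun r hr => Finset.min'_le _ r hr⟩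
      simp only [Finset.mem_filter] at h1 h2
      refine ⟨x, ?_, ?_, ?_⟩ <;> grind
    have hx2 := Finset.disjoint_left.1 hU.1 hx
    have hd := Finset.disjoint_left.1 hU.1
    have hcard1 := Finset.card_erase_add_one hx
    have hcard2 := Finset.card_erase_add_one hy
    have hyx1 : y ∉ U.1.erase x := by grind
    refine ⟨(insert y (U.1.erase x), U.2.erase y), ⟨?_, fun k => ?_⟩, ?_,
      .inl ⟨x, .inr ⟨y, by grind, hyx, by grind, by grind, by grind, by grind, ?_⟩⟩⟩
    · rw [Finset.disjoint_left]
      grind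
    · dsimp only
      rw [card_filter_le_insert hyx1]
      have h1 := card_filter_le_erase hx k
      have h2 := card_filter_le_erase hy k
      have h3 := hU.2 k
      have h4 := hU.2 y
      by_cases hky : k ≤ y
      · simp only [hky, if_true, (by omega : k ≤ x)] at h1 h2 ⊢
        omega
      · by_cases hkx : k ≤ x
        · simp only [hky, if_false, hkx, if_true] at h1 h2 ⊢
          have h5 : (U.1.filter (k ≤ ·)) = (U.1.filter (y ≤ ·)) := by
            ext
            grind
          have h6 : U.2.filter (k ≤ ·) ⊆ (U.2.erase y).filter (y ≤ ·) := by
            intro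
            grind
          have h7 := Finset.card_le_card h6
          have h8 := card_filter_le_erase hy y
          simp only [le_refl, if_true] at h8
          rw [h5] at h1
          omega
        · simp only [hky, if_false, hkx] at h1 h2 ⊢
          omega
    · simp [shape, Finset.card_insert_of_notMem hyx1]
      omega
    · ext z <;> grind
  · exact ⟨U, hU, by simp [shape]; omega, .inr rfl⟩

end Tableaux

section Chains

/-- Some entry of the second row and some larger entry of the first row both lie in `[b, k]`. -/
def HasInversion (T : Tab) (b k : ℕ) : Prop :=
  ∃ s ∈ T.2, ∃ r ∈ T.1, b ≤ s ∧ s < r ∧ r ≤ k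

theorem RowInsert.hasInversion_iff {x : ℕ} {T T' : Tab} (h : RowInsert x T T') (b k : ℕ) :
    HasInversion T' b k ↔
      HasInversion T b k ∨ x ≤ k ∧ ∃ z, (z ∈ T.1 ∨ z ∈ T.2) ∧ b ≤ z ∧ z < x := by
  rcases h with ⟨hx, -, rfl⟩ | ⟨y, hy, hyx, hx1, hx2, hmax, hs, rfl⟩
  · constructor
    · rintro ⟨s, hs, r, hr, h1, h2, h3⟩
      rcases Finset.mem_insert.1 hr with rfl | hr
      · exact .inr ⟨h3, s, .inr hs, h1, h2⟩
      · exact .inl ⟨s, hs, r, hr, h1, h2, h3⟩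
    · rintro (⟨s, hs, r, hr, h⟩ | ⟨hk, z, hz | hz, h1, h2⟩)
      · exact ⟨s, hs, r, Finset.mem_insert_of_mem hr, h⟩
      · exact absurd (hx z hz) h2.asymm
      · exact ⟨z, hz, x, Finset.mem_insert_self _ _, h1, h2, hk⟩
  · constructor
    · rintro ⟨s, hs', r, hr, h1, h2, h3⟩
      rcases Finset.mem_insert.1 hr with rfl | hr
      · refine .inr ⟨h3, s, ?_, h1, h2⟩
        rcases Finset.mem_insert.1 hs' with rfl | hs'
        exacts [.inl hy, .inr hs']
      · have hr' := Finset.mem_of_mem_erase hr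
        rcases Finset.mem_insert.1 hs' with rfl | hs'
        · have : x ≤ r := by
            by_contra! hlt
            exact absurd (hmax r hr' hlt) h2.not_ge
          exact .inr ⟨this.trans h3, s, .inl hy, h1, hyx⟩
        · exact .inl ⟨s, hs', r, hr', h1, h2, h3⟩
    · rintro (⟨s, hs', r, hr, h1, h2, h3⟩ | ⟨hk, z, hz | hz, h1, h2⟩)
      · refine ⟨s, Finset.mem_insert_of_mem hs', r, Finset.mem_insert_of_mem ?_, h1, h2, h3⟩
        exact Finset.mem_erase.2 ⟨fun e => absurd (hs s hs') (e ▸ h2).asymm, hr⟩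
      · exact ⟨y, Finset.mem_insert_self _ _, x, Finset.mem_insert_self _ _,
          h1.trans (hmax z hz h2), hyx, hk⟩
      · exact ⟨z, Finset.mem_insert_of_mem hz, x, Finset.mem_insert_self _ _, h1, h2, hk⟩

theorem hasInversion_delete_iff {t b k : ℕ} (T : Tab) (h : t < b) :
    HasInversion (delete t T) b k ↔ HasInversion T b k := by
  simp only [HasInversion, delete, Finset.mem_erase]
  constructor
  · rintro ⟨s, hs, r, hr, h'⟩
    exact ⟨s, hs.2, r, hr.2, h'⟩
  · rintro ⟨s, hs, r, hr, h'⟩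
    exact ⟨s, ⟨by omega, hs⟩, r, ⟨by omega, hr⟩, h'⟩

/-- The row insertion of `x` is possible unless `x` is the top of an increasing triple. -/
theorem exists_rowInsert {x : ℕ} {T : Tab} (hT : IsStd T) (hx1 : x ∉ T.1) (hx2 : x ∉ T.2)
    (h : ∀ s ∈ T.2, ∀ r ∈ T.1, s < r → x ≤ r) : ∃ T', RowInsert x T T' := by
  by_cases hlt : ∀ r ∈ T.1, x < r
  · exact ⟨_, .inl ⟨hlt, hx2, rfl⟩⟩
  · push Not at hlt
    obtain ⟨r, hr, hrx⟩ := hlt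
    have hne : (T.1.filter (· < x)).Nonempty := by
      refine ⟨r, Finset.mem_filter.2 ⟨hr, lt_of_le_of_ne hrx ?_⟩⟩
      rintro rfl
      exact hx1 hr
    obtain ⟨y, hy, hmax⟩ : ∃ y ∈ T.1.filter (· < x), ∀ r ∈ T.1.filter (· < x), r ≤ y :=
      ⟨_, Finset.max'_mem _ hne, fun r hr => Finset.le_max' _ r hr⟩
    simp only [Finset.mem_filter] at hy hmax
    refine ⟨_, .inr ⟨y, hy.1, hy.2, hx1, hx2, fun r hr hr' => hmax r ⟨hr, hr'⟩,
      fun s hs => ?_, rfl⟩⟩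
    by_contra! hsy
    have hne : s ≠ y := by
      rintro rfl
      exact Finset.disjoint_left.1 hT.1 hy.1 hs
    exact absurd (h s hs y hy.1 (lt_of_le_of_ne hsy hne)) hy.2.not_ge

theorem RowInsert.le_of_lt {x : ℕ} {T T' : Tab} (h : RowInsert x T T') {s r : ℕ} (hs : s ∈ T.2)
    (hr : r ∈ T.1) (hsr : s < r) : x ≤ r := by
  rcases h with ⟨hx, -, -⟩ | ⟨y, hy, hyx, hx1, hx2, hmax, hs', -⟩
  · exact (hx r hr).le
  · by_contra! hrx
    exact absurd ((hs' s hs).trans hsr) (hmax r hr hrx).not_gt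

/-- `A` is the arc relation of a partial matching of openers with closers in `{0, …, N - 1}`. -/
structure ArcSystem (N : ℕ) (A : ℕ → ℕ → Prop) : Prop where
  lt : ∀ {i j}, A i j → i < j
  bound : ∀ {i j}, A i j → j < N
  right_unique : ∀ {i j k}, A i j → A i k → j = k
  left_unique : ∀ {i j k}, A i k → A j k → i = j

/-- No three arcs of `A` mutually cross. -/
def NoTripleCrossing (A : ℕ → ℕ → Prop) : Prop :=
  ∀ v₁ v₂ v₃ z₁ z₂ z₃, A v₁ z₁ → A v₂ z₂ → A v₃ z₃ → v₁ < v₂ → v₂ < v₃ → v₃ < z₁ →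
    z₁ < z₂ → ¬ z₂ < z₃

/-- `U` arises from `S` by inserting the closer of the arc opened at `i`, if there is one. -/
def OpenStep (A : ℕ → ℕ → Prop) (i : ℕ) (S U : Tab) : Prop :=
  (∃ x, A i x ∧ RowInsert x S U) ∨ (∀ x, ¬ A i x) ∧ U = S

/-- The tableaux `S i` and `U i` before and after the insertion at vertex `i`. -/
structure Chain (A : ℕ → ℕ → Prop) (S U : ℕ → Tab) : Prop where
  zero : S 0 = (∅, ∅)
  up : ∀ i, OpenStep A i (S i) (U i)
  down : ∀ i, S (i + 1) = delete (i + 1) (U i)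

variable {N : ℕ} {A : ℕ → ℕ → Prop} {S U : ℕ → Tab}

theorem OpenStep.mem_iff {i : ℕ} {T T' : Tab} (hA : ArcSystem N A) (h : OpenStep A i T T')
    (hT : ∀ z, (z ∈ T.1 ∨ z ∈ T.2) ↔ i < z ∧ ∃ v < i, A v z) (z : ℕ) :
    (z ∈ T'.1 ∨ z ∈ T'.2) ↔ i < z ∧ ∃ v ≤ i, A v z := by
  rcases h with ⟨x, hx, h⟩ | ⟨hx, rfl⟩
  · rw [h.mem_iff, hT]
    constructor
    · rintro (rfl | ⟨h1, v, h2, h3⟩)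
      · exact ⟨hA.lt hx, i, le_rfl, hx⟩
      · exact ⟨h1, v, h2.le, h3⟩
    · rintro ⟨h1, v, h2, h3⟩
      rcases h2.lt_or_eq with h2 | rfl
      · exact .inr ⟨h1, v, h2, h3⟩
      · exact .inl (hA.right_unique h3 hx)
  · rw [hT]
    refine and_congr_right fun _ => ⟨fun ⟨v, h, h'⟩ => ⟨v, h.le, h'⟩, fun ⟨v, h, h'⟩ => ⟨v, ?_, h'⟩⟩
    refine lt_of_le_of_ne h ?_
    rintro rfl
    exact hx z h'

theorem mem_delete_iff {i : ℕ} {T : Tab} (hT : ∀ z, (z ∈ T.1 ∨ z ∈ T.2) ↔ i < z ∧ ∃ v ≤ i, A v z)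
    (z : ℕ) : (z ∈ (delete (i + 1) T).1 ∨ z ∈ (delete (i + 1) T).2) ↔
      i + 1 < z ∧ ∃ v < i + 1, A v z := by
  simp only [delete, Finset.mem_erase, ← and_or_left, hT, Nat.lt_succ_iff]
  rw [← and_assoc]
  refine and_congr_left fun _ => ?_
  omega

/-- The data carried along a chain of tableaux up to the insertion at vertex `i`. -/
structure Good (A : ℕ → ℕ → Prop) (i : ℕ) (T : Tab) : Prop where
  std : IsStd T
  mem_iff : ∀ z, (z ∈ T.1 ∨ z ∈ T.2) ↔ i < z ∧ ∃ v < i, A v z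
  inversion_iff : ∀ b k, i < b → (HasInversion T b k ↔
    ∃ v v' z z', v < v' ∧ v' < i ∧ A v z ∧ A v' z' ∧ b ≤ z ∧ z < z' ∧ z' ≤ k)

theorem good_zero : Good A 0 (∅, ∅) :=
  ⟨isStd_empty, by simp, by simp [HasInversion]⟩

theorem OpenStep.isStd {i : ℕ} {T T' : Tab} (h : OpenStep A i T T') (hT : IsStd T) :
    IsStd T' := by
  rcases h with ⟨x, -, h⟩ | ⟨-, rfl⟩
  exacts [h.isStd hT, hT]

theorem Good.succ {i : ℕ} {T T' : Tab} (hA : ArcSystem N A) (hT : Good A i T)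
    (h : OpenStep A i T T') : Good A (i + 1) (delete (i + 1) T') := by
  have hm := h.mem_iff hA hT.mem_iff
  refine ⟨(h.isStd hT.std).delete (fun r hr => ((hm r).1 (.inl hr)).1)
    (fun r hr => ((hm r).1 (.inr hr)).1), mem_delete_iff hm, fun b k hb => ?_⟩
  rw [hasInversion_delete_iff _ hb]
  rcases h with ⟨x, hx, h⟩ | ⟨hx, rfl⟩
  · rw [h.hasInversion_iff, hT.inversion_iff b k (by omega)]
    constructor
    · rintro (⟨v, v', z, z', h1, h2, h3⟩ | ⟨hk, z, hz, h1, h2⟩)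
      · exact ⟨v, v', z, z', h1, by omega, h3⟩
      · obtain ⟨-, v, hv, hvz⟩ := (hT.mem_iff z).1 hz
        exact ⟨v, i, z, x, hv, by omega, hvz, hx, h1, h2, hk⟩
    · rintro ⟨v, v', z, z', h1, h2, h3, h4, h5, h6, h7⟩
      rcases (Nat.lt_succ_iff.1 h2).lt_or_eq with h2 | rfl
      · exact .inl ⟨v, v', z, z', h1, h2, h3, h4, h5, h6, h7⟩
      · obtain rfl := hA.right_unique hx h4
        exact .inr ⟨h7, z, (hT.mem_iff z).2 ⟨by omega, v, h1, h3⟩, h5, h6⟩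
  · rw [hT.inversion_iff b k (by omega)]
    constructor
    · rintro ⟨v, v', z, z', h1, h2, h3⟩
      exact ⟨v, v', z, z', h1, by omega, h3⟩
    · rintro ⟨v, v', z, z', h1, h2, h3, h4, h5⟩
      refine ⟨v, v', z, z', h1, lt_of_le_of_ne (Nat.lt_succ_iff.1 h2) ?_, h3, h4, h5⟩
      rintro rfl
      exact hx _ h4

theorem Good.exists_openStep {i : ℕ} {T : Tab} (hA : ArcSystem N A) (hA3 : NoTripleCrossing A)
    (hT : Good A i T) : ∃ T', OpenStep A i T T' := by
  by_cases h : ∃ x, A i x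
  · obtain ⟨x, hx⟩ := h
    have hx' : ¬ (x ∈ T.1 ∨ x ∈ T.2) := by
      rw [hT.mem_iff]
      rintro ⟨-, v, hv, hvx⟩
      exact hv.ne (hA.left_unique hvx hx)
    push Not at hx'
    obtain ⟨T', hT'⟩ : ∃ T', RowInsert x T T' := by
      refine exists_rowInsert hT.std hx'.1 hx'.2 fun s hs r hr hsr => ?_
      by_contra! hrx
      have hi := ((hT.mem_iff s).1 (.inr hs)).1
      obtain ⟨v, v', z, z', h1, h2, h3, h4, h5, h6, h7⟩ :=
        (hT.inversion_iff s r hi).1 ⟨s, hs, r, hr, le_rfl, hsr, le_rfl⟩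
      exact hA3 v v' i z z' x h3 h4 hx h1 h2 (by omega) h6 (by omega)
    exact ⟨T', .inl ⟨x, hx, hT'⟩⟩
  · exact ⟨T, .inr ⟨not_exists.1 h, rfl⟩⟩

theorem OpenStep.unique {i : ℕ} {T T₁ T₂ : Tab} (hA : ArcSystem N A) (h₁ : OpenStep A i T T₁)
    (h₂ : OpenStep A i T T₂) : T₁ = T₂ := by
  rcases h₁ with ⟨x, hx, h₁⟩ | ⟨hx, rfl⟩ <;> rcases h₂ with ⟨x', hx', h₂⟩ | ⟨hx', rfl⟩
  · obtain rfl := hA.right_unique hx hx'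
    exact h₁.unique_right h₂
  · exact absurd hx (hx' x)
  · exact absurd hx' (hx x')
  · rfl

theorem Chain.good (hA : ArcSystem N A) (h : Chain A S U) (i : ℕ) : Good A i (S i) := by
  induction i with
  | zero => exact h.zero ▸ good_zero
  | succ i ih => exact h.down i ▸ ih.succ hA (h.up i)

theorem Chain.mem_up_iff (hA : ArcSystem N A) (h : Chain A S U) (i z : ℕ) :
    (z ∈ (U i).1 ∨ z ∈ (U i).2) ↔ i < z ∧ ∃ v ≤ i, A v z :=
  (h.up i).mem_iff hA (h.good hA i).mem_iff z

theorem Chain.isStd_up (hA : ArcSystem N A) (h : Chain A S U) (i : ℕ) : IsStd (U i) :=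
  (h.up i).isStd (h.good hA i).std

theorem Chain.noTripleCrossing (hA : ArcSystem N A) (h : Chain A S U) : NoTripleCrossing A := by
  intro v₁ v₂ v₃ z₁ z₂ z₃ h1 h2 h3 h12 h23 h31 hz12 hz23
  obtain ⟨s, hs, r, hr, hsr⟩ := ((h.good hA v₃).inversion_iff z₁ z₂ h31).2
    ⟨v₁, v₂, z₁, z₂, h12, h23, h1, h2, le_rfl, hz12, le_rfl⟩
  rcases h.up v₃ with ⟨x, hx, hu⟩ | ⟨hx, -⟩
  · obtain rfl := hA.right_unique hx h3
    have := hu.le_of_lt hs hr hsr.2.1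
    omega
  · exact hx _ h3

theorem exists_chain (hA : ArcSystem N A) (hA3 : NoTripleCrossing A) :
    ∃ S U, Chain A S U := by
  have step : ∀ i T, ∃ T', Good A i T → OpenStep A i T T' := fun i T => by
    by_cases hT : Good A i T
    · obtain ⟨T', h⟩ := hT.exists_openStep hA hA3
      exact ⟨T', fun _ => h⟩
    · exact ⟨T, fun h => absurd h hT⟩
  choose f hf using step
  let S : ℕ → Tab := fun n => Nat.rec (∅, ∅) (fun i T => delete (i + 1) (f i T)) n
  have hS : ∀ i, Good A i (S i) := by
    intro i
    induction i with
    | zero => exact good_zero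
    | succ i ih => exact ih.succ hA (hf i _ ih)
  exact ⟨S, fun i => f i (S i), rfl, fun i => hf i _ (hS i), fun i => rfl⟩

theorem Chain.unique {S' U' : ℕ → Tab} (hA : ArcSystem N A) (h : Chain A S U)
    (h' : Chain A S' U') : S = S' ∧ U = U' := by
  have hS : ∀ i, S i = S' i := by
    intro i
    induction i with
    | zero => rw [h.zero, h'.zero]
    | succ i ih =>
      rw [h.down, h'.down, (h.up i).unique hA (ih ▸ h'.up i)]
  exact ⟨funext hS, funext fun i => (h.up i).unique hA (hS i ▸ h'.up i)⟩

theorem Chain.eq_empty (hA : ArcSystem N A) (h : Chain A S U) {i : ℕ} (hi : N ≤ i + 1) :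
    S i = (∅, ∅) ∧ U i = (∅, ∅) := by
  have h1 : ∀ z, ¬ (z ∈ (S i).1 ∨ z ∈ (S i).2) := by
    intro z
    rw [(h.good hA i).mem_iff]
    rintro ⟨hz, v, -, hv⟩
    have := hA.bound hv
    omega
  have h2 : ∀ z, ¬ (z ∈ (U i).1 ∨ z ∈ (U i).2) := by
    intro z
    rw [h.mem_up_iff hA]
    rintro ⟨hz, v, -, hv⟩
    have := hA.bound hv
    omega
  simp only [not_or, forall_and, ← Finset.eq_empty_iff_forall_notMem] at h1 h2
  exact ⟨Prod.ext h1.1 h1.2, Prod.ext h2.1 h2.2⟩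

theorem OpenStep.upStep {i : ℕ} {T T' : Tab} (h : OpenStep A i T T') (hT : IsStd T) :
    UpStep (shape T' - shape T) := by
  rcases h with ⟨x, -, h | h⟩ | ⟨-, rfl⟩
  · exact .inl h.shape_sub
  · exact .inr (.inl (h.shape_sub hT))
  · exact .inr (.inr (sub_self _))

theorem Chain.downStep (hA : ArcSystem N A) (h : Chain A S U) (i : ℕ) :
    DownStep (shape (S (i + 1)) - shape (U i)) := by
  rw [h.down]
  rcases shape_delete (h.isStd_up hA i) (i + 1) with h | h | h
  · exact .inl h.2
  · exact .inr (.inl h.2)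
  · exact .inr (.inr h.2.2)

/-- Up-down pairs along the first row correspond to arcs between neighbouring vertices. -/
theorem Chain.up_down_iff (hA : ArcSystem N A) (h : Chain A S U) (i : ℕ) :
    (shape (U i) - shape (S i) = (1, 0) ∧ shape (S (i + 1)) - shape (U i) = (-1, 0)) ↔
      A i (i + 1) := by
  have hS := h.good hA i
  have hU := h.isStd_up hA i
  have hdel := shape_delete hU (i + 1)
  have hd := Finset.disjoint_left.1 hU.1
  rw [h.down]
  constructor
  · rintro ⟨h1, h2⟩
    have hmem : i + 1 ∈ (U i).1 := by
      rw [h2] at hdel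
      simpa using hdel
    rcases h.up i with ⟨x, hx, hr | hr⟩ | ⟨-, hr⟩
    · obtain ⟨hr, -, e⟩ := hr
      rw [e] at hmem
      rcases Finset.mem_insert.1 hmem with rfl | hmem
      · exact hx
      · have := hr _ hmem
        have := hA.lt hx
        omega
    · rw [hr.shape_sub hS.std] at h1
      simp at h1
    · rw [hr, sub_self] at h1
      exact absurd h1 (by decide)
  · intro hi
    rcases h.up i with ⟨x, hx, hr⟩ | ⟨hx, -⟩
    · obtain rfl := hA.right_unique hi hx
      rcases hr with hr | ⟨y, hy, hyi, -⟩
      · refine ⟨hr.shape_sub, ?_⟩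
        have hmem : i + 1 ∈ (U i).1 := by
          rw [hr.2.2]
          exact Finset.mem_insert_self _ _
        rcases hdel with h | h | h
        · exact h.2
        · exact absurd h.1 (hd hmem)
        · exact absurd hmem h.1
      · have := ((hS.mem_iff y).1 (.inl hy)).1
        omega
    · exact absurd hi (hx _)

end Chains


section Walks

variable {N : ℕ} {A A' : ℕ → ℕ → Prop} {S U S' U' : ℕ → Tab}

/-- The walk of shapes of the tableaux `S 0, U 0, S 1, U 1, …`. -/
def chainWalk (S U : ℕ → Tab) (r : ℕ) : ℤ × ℤ :=
  if r % 2 = 0 then shape (S (r / 2)) else shape (U (r / 2))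

theorem chainWalk_even (S U : ℕ → Tab) (i : ℕ) : chainWalk S U (2 * i) = shape (S i) := by
  simp [chainWalk]

theorem chainWalk_odd (S U : ℕ → Tab) (i : ℕ) : chainWalk S U (2 * i + 1) = shape (U i) := by
  have h1 : (2 * i + 1) % 2 = 1 := by omega
  have h2 : (2 * i + 1) / 2 = i := by omega
  simp [chainWalk, h1, h2]

theorem isBStarWalk_iff {M : ℕ} {w : ℕ → ℤ × ℤ} :
    (IsBStarWalk (2 * M) w ∧ w (2 * M) = (1, 0)) ↔
      w 0 = (1, 0) ∧ (∀ r, w r ∈ W2) ∧ (∀ i, UpStep (w (2 * i + 1) - w (2 * i))) ∧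
      (∀ i, DownStep (w (2 * i + 2) - w (2 * i + 1))) ∧
      (∀ i, ¬ (w (2 * i + 1) - w (2 * i) = (1, 0) ∧
        w (2 * i + 2) - w (2 * i + 1) = (-1, 0))) ∧
      ∀ r, 2 * M ≤ r → w r = (1, 0) := by
  constructor
  · rintro ⟨⟨⟨h0, hW, hu, hd, hc⟩, hn⟩, he⟩
    have hc' : ∀ r, 2 * M ≤ r → w r = (1, 0) := fun r hr => (hc r hr).trans he
    refine ⟨h0, fun r => ?_, fun i => ?_, fun i => ?_, fun i => ?_, hc'⟩
    · rcases le_total r (2 * M) with h | h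
      · exact hW r h
      · simp [hc' r h, W2]
    · by_cases h : i < M
      · exact hu (2 * i + 1) (by omega) (by omega) (by omega)
      · rw [hc' _ (by omega), hc' _ (by omega)]
        exact .inr (.inr (sub_self _))
    · by_cases h : i < M
      · exact hd (2 * i + 2) (by omega) (by omega) (by omega)
      · rw [hc' _ (by omega), hc' _ (by omega)]
        exact .inr (.inr (sub_self _))
    · by_cases h : i < M
      · exact hn (i + 1) (by omega) (by omega)
      · rw [hc' _ (by omega), hc' (2 * i) (by omega)]
        simp [Prod.ext_iff]
  · rintro ⟨h0, hW, hu, hd, hn, hc⟩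
    refine ⟨⟨⟨h0, fun r _ => hW r, fun r h1 _ hr => ?_, fun r h1 _ hr => ?_, fun r hr => ?_⟩,
      fun q hq _ => ?_⟩, hc _ le_rfl⟩
    · obtain ⟨i, rfl⟩ : ∃ i, r = 2 * i + 1 := ⟨r / 2, by omega⟩
      exact hu i
    · obtain ⟨i, rfl⟩ : ∃ i, r = 2 * i + 2 := ⟨r / 2 - 1, by omega⟩
      exact hd i
    · rw [hc r hr, hc _ le_rfl]
    · obtain ⟨i, rfl⟩ : ∃ i, q = i + 1 := ⟨q - 1, by omega⟩
      exact hn i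

theorem Chain.isBStarWalk {M : ℕ} (hA : ArcSystem (M + 1) A) (h : Chain A S U)
    (hr : ∀ i, ¬ A i (i + 1)) :
    IsBStarWalk (2 * M) (chainWalk S U) ∧ chainWalk S U (2 * M) = (1, 0) := by
  have hS : ∀ i, chainWalk S U (2 * i + 2) = shape (S (i + 1)) :=
    fun i => chainWalk_even S U (i + 1)
  refine isBStarWalk_iff.2 ⟨?_, fun r => ?_, fun i => ?_, fun i => ?_, fun i => ?_,
    fun r hr => ?_⟩
  · rw [← mul_zero 2, chainWalk_even, h.zero]
    simp [shape]
  · unfold chainWalk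
    split_ifs
    exacts [(h.good hA _).std.shape_mem, (h.isStd_up hA _).shape_mem]
  · rw [chainWalk_even, chainWalk_odd]
    exact (h.up i).upStep (h.good hA i).std
  · rw [hS, chainWalk_odd]
    exact h.downStep hA i
  · rw [hS, chainWalk_even, chainWalk_odd, h.up_down_iff hA]
    exact hr i
  · have := h.eq_empty hA (i := r / 2) (by omega)
    simp [chainWalk, this, shape]

theorem OpenStep.unique_left {i : ℕ} {T₁ T₂ T : Tab} (hA : ArcSystem N A)
    (hA' : ArcSystem N A') (hT₁ : IsStd T₁) (hT₂ : IsStd T₂) (h₁ : OpenStep A i T₁ T)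
    (h₂ : OpenStep A' i T₂ T) (hs : shape T₁ = shape T₂) :
    T₁ = T₂ ∧ ∀ x, A i x ↔ A' i x := by
  have key : ∀ x x', A i x → A' i x' → x = x' → ∀ z, A i z ↔ A' i z := by
    rintro x _ hx hx' rfl z
    exact ⟨fun hz => hA.right_unique hx hz ▸ hx', fun hz => hA'.right_unique hx' hz ▸ hx⟩
  rcases h₁ with ⟨x, hx, h₁ | h₁⟩ | ⟨hx, rfl⟩ <;> rcases h₂ with ⟨x', hx', h₂ | h₂⟩ | ⟨hx', h₂⟩
  · have := h₁.unique_left h₂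
    exact ⟨this.2, key x x' hx hx' this.1⟩
  · have e₁ := h₁.shape_sub
    have e₂ := h₂.shape_sub hT₂
    rw [hs, e₂] at e₁
    simp at e₁
  · have e₁ := h₁.shape_sub
    rw [hs, h₂, sub_self] at e₁
    simp [Prod.ext_iff] at e₁
  · have e₁ := h₁.shape_sub hT₁
    have e₂ := h₂.shape_sub
    rw [hs, e₂] at e₁
    simp at e₁
  · have := h₁.unique_left hT₁ hT₂ h₂
    exact ⟨this.2, key x x' hx hx' this.1⟩
  · have e₁ := h₁.shape_sub hT₁
    rw [hs, h₂, sub_self] at e₁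
    simp [Prod.ext_iff] at e₁
  · have e₂ := h₂.shape_sub
    rw [hs, sub_self] at e₂
    simp [Prod.ext_iff] at e₂
  · have e₂ := h₂.shape_sub hT₂
    rw [hs, sub_self] at e₂
    simp [Prod.ext_iff] at e₂
  · exact ⟨h₂, fun x => iff_of_false (hx x) (hx' x)⟩

theorem Chain.arcs_unique (hA : ArcSystem N A) (hA' : ArcSystem N A') (h : Chain A S U)
    (h' : Chain A' S' U') (hw : chainWalk S U = chainWalk S' U') (i x : ℕ) :
    A i x ↔ A' i x := by
  have hs : ∀ i, shape (S i) = shape (S' i) := fun i => by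
    rw [← chainWalk_even S U, ← chainWalk_even S' U', hw]
  have hu : ∀ i, shape (U i) = shape (U' i) := fun i => by
    rw [← chainWalk_odd S U, ← chainWalk_odd S' U', hw]
  have hU : ∀ i, S (i + 1) = S' (i + 1) → U i = U' i := fun i e =>
    delete_unique (h.isStd_up hA i) (h'.isStd_up hA' i) (by rw [← h.down, ← h'.down, e]) (hu i)
  have hl : ∀ i, U i = U' i → S i = S' i ∧ ∀ x, A i x ↔ A' i x := fun i e =>
    OpenStep.unique_left hA hA' (h.good hA i).std (h'.good hA' i).std (h.up i)
      (e ▸ h'.up i) (hs i)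
  have hS : ∀ d i, N ≤ i + d → S i = S' i := by
    intro d
    induction d with
    | zero =>
      intro i hi
      rw [(h.eq_empty hA (by omega)).1, (h'.eq_empty hA' (by omega)).1]
    | succ d ih => exact fun i hi => (hl i (hU i (ih _ (by omega)))).1
  exact (hl i (hU i (hS N _ (by omega)))).2 x

theorem exists_tableaux {w : ℕ → ℤ × ℤ} (h0 : w 0 = (1, 0)) (hW : ∀ r, w r ∈ W2)
    (hu : ∀ i, UpStep (w (2 * i + 1) - w (2 * i)))
    (hd : ∀ i, DownStep (w (2 * i + 2) - w (2 * i + 1))) (t : ℕ) :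
    ∀ V : Tab, IsStd V → (∀ r ∈ V.1, t < r) → (∀ r ∈ V.2, t < r) → shape V = w (2 * t) →
      ∃ S U : ℕ → Tab, S 0 = (∅, ∅) ∧
        (∀ i < t, ((∃ x, RowInsert x (S i) (U i)) ∨ U i = S i) ∧
          S (i + 1) = delete (i + 1) (U i) ∧ shape (S i) = w (2 * i) ∧
          shape (U i) = w (2 * i + 1) ∧ ∀ r, r ∈ (U i).1 ∨ r ∈ (U i).2 → i < r) ∧
        ∀ i, t ≤ i → S i = V ∧ U i = V := by
  induction t with
  | zero =>
    intro V _ _ _ hs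
    exact ⟨fun _ => V, fun _ => V, eq_empty_of_shape_eq (hs.trans h0), by simp, by simp⟩
  | succ t ih =>
    intro V hV hV1 hV2 hs
    obtain ⟨U₀, hU₀, hU1, hU2, hUs, hUd⟩ := exists_reverse_delete hV hV1 hV2 (hW (2 * t + 1))
      (hs ▸ hd t)
    obtain ⟨V₀, hV₀, hVs, hVi⟩ := exists_reverse_insert hU₀ (hW (2 * t)) (hUs ▸ hu t)
    have hmem : ∀ r, r ∈ V₀.1 ∨ r ∈ V₀.2 → t < r := by
      intro r hr
      have : r ∈ U₀.1 ∨ r ∈ U₀.2 := by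
        rcases hVi with ⟨x, hx⟩ | rfl
        · exact (hx.mem_iff r).2 (.inr hr)
        · exact hr
      exact this.elim (hU1 r) (hU2 r)
    obtain ⟨S, U, hS0, hSU, hend⟩ := ih V₀ hV₀ (fun r hr => hmem r (.inl hr))
      (fun r hr => hmem r (.inr hr)) hVs
    refine ⟨fun i => if i ≤ t then S i else V,
      fun i => if i < t then U i else if i = t then U₀ else V, by simpa using hS0,
      fun i hi => ?_, fun i hi => ?_⟩
    · rcases Nat.lt_succ_iff_lt_or_eq.1 hi with hi | rfl
      · simpa [hi, hi.le, Nat.succ_le_of_lt hi] using hSU i hi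
      · have e := (hend i le_rfl).1
        simp only [lt_irrefl, if_false, if_true, le_rfl, e, Nat.not_succ_le_self]
        exact ⟨hVi, hUd.symm, hVs, hUs, fun r hr => hr.elim (hU1 r) (hU2 r)⟩
    · have h1 : ¬ i ≤ t := by omega
      have h2 : ¬ i < t := by omega
      have h3 : ¬ i = t := by omega
      simp [h1, h2, h3]

theorem exists_chain_of_isBStarWalk {M : ℕ} {w : ℕ → ℤ × ℤ}
    (hw : IsBStarWalk (2 * M) w ∧ w (2 * M) = (1, 0)) :
    ∃ A S U, ArcSystem (M + 1) A ∧ Chain A S U ∧ (∀ i, ¬ A i (i + 1)) ∧ chainWalk S U = w := by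
  obtain ⟨h0, hW, hu, hd, hn, hc⟩ := isBStarWalk_iff.1 hw
  obtain ⟨S, U, hS0, hSU, hend⟩ := exists_tableaux h0 hW hu hd M (∅, ∅) isStd_empty (by simp)
    (by simp) (by simp [hc _ le_rfl, shape])
  have hall : ∀ i, ((∃ x, RowInsert x (S i) (U i)) ∨ U i = S i) ∧
      S (i + 1) = delete (i + 1) (U i) ∧ shape (S i) = w (2 * i) ∧
      shape (U i) = w (2 * i + 1) ∧ ∀ r, r ∈ (U i).1 ∨ r ∈ (U i).2 → i < r := by
    intro i
    by_cases hi : i < M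
    · exact hSU i hi
    · have e := hend i (by omega)
      rw [(hend (i + 1) (by omega)).1, e.1, e.2, hc _ (by omega), hc _ (by omega)]
      simp [delete, shape]
  have hmono : ∀ i, ∀ z, z ∈ (S i).1 ∨ z ∈ (S i).2 → z ∈ (U i).1 ∨ z ∈ (U i).2 := by
    intro i z hz
    rcases (hall i).1 with ⟨x, hx⟩ | e
    · exact (hx.mem_iff z).2 (.inr hz)
    · rwa [e]
  have hpersist : ∀ i j z, z ∈ (U i).1 ∨ z ∈ (U i).2 → i < j → j < z →
      z ∈ (S j).1 ∨ z ∈ (S j).2 := by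
    intro i j z hz hij
    induction j, hij using Nat.le_induction with
    | base =>
      intro hj
      rw [(hall i).2.1]
      simpa [delete, hj.ne'] using hz
    | succ j hj ih =>
      intro hjz
      rw [(hall j).2.1]
      simpa [delete, hjz.ne'] using hmono j z (ih (by omega))
  let A : ℕ → ℕ → Prop := fun i x => RowInsert x (S i) (U i)
  have hmem : ∀ {i x}, A i x → x ∈ (U i).1 ∨ x ∈ (U i).2 := fun {i x} h =>
    (RowInsert.mem_iff h x).2 (.inl rfl)
  have hlt : ∀ {i x}, A i x → i < x := fun {i x} h => (hall i).2.2.2.2 x (hmem h)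
  have hleft : ∀ {i j x}, A i x → A j x → ¬ i < j := fun {i j x} hi hj hij =>
    not_or.2 (RowInsert.notMem hj) (hpersist i j x (hmem hi) hij (hlt hj))
  have hA : ArcSystem (M + 1) A := by
    refine ⟨hlt, fun {i x} h => ?_, fun {i x y} hx hy => ?_, fun {i j x} hi hj => ?_⟩
    · by_contra hx
      have hiM : i < M := by
        by_contra hi
        have := hmem h
        simp [(hend i (by omega)).2] at this
      have := hpersist i M x (hmem h) hiM (by omega)
      simp [(hend M le_rfl).1] at this
    · rcases (RowInsert.mem_iff hx y).1 (hmem hy) with h | h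
      · exact h.symm
      · exact absurd h (not_or.2 (RowInsert.notMem hy))
    · exact le_antisymm (not_lt.1 (hleft hj hi)) (not_lt.1 (hleft hi hj))
  have hC : Chain A S U := by
    refine ⟨hS0, fun i => ?_, fun i => (hall i).2.1⟩
    rcases (hall i).1 with ⟨x, hx⟩ | e
    · exact .inl ⟨x, hx, hx⟩
    · exact .inr ⟨fun x hx => not_or.2 (RowInsert.notMem hx) (e ▸ hmem hx), e⟩
  have hS : ∀ i, shape (S i) = w (2 * i) := fun i => (hall i).2.2.1
  have hU : ∀ i, shape (U i) = w (2 * i + 1) := fun i => (hall i).2.2.2.1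
  refine ⟨A, S, U, hA, hC, fun i hi => hn i ?_, funext fun r => ?_⟩
  · rw [← hC.up_down_iff hA, hS, hU, hS] at hi
    exact hi
  · rcases Nat.even_or_odd' r with ⟨i, rfl | rfl⟩
    · rw [chainWalk_even, hS]
    · rw [chainWalk_odd, hU]

end Walks

section Partitions

variable {N : ℕ}

theorem sameBlock_iff_mem_part {P : Finpartition (Finset.univ : Finset (Fin N))} {i j : Fin N} :
    SameBlock P i j ↔ i ∈ P.part j :=
  P.mem_part_iff_exists.symm

theorem sameBlock_iff_part_eq {P : Finpartition (Finset.univ : Finset (Fin N))} {i j : Fin N} :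
    SameBlock P i j ↔ P.part i = P.part j := by
  rw [sameBlock_iff_mem_part,
    P.mem_part_iff_part_eq_part (Finset.mem_univ _) (Finset.mem_univ _)]

theorem SameBlock.trans {P : Finpartition (Finset.univ : Finset (Fin N))} {i j k : Fin N}
    (h : SameBlock P i j) (h' : SameBlock P j k) : SameBlock P i k :=
  sameBlock_iff_part_eq.2 ((sameBlock_iff_part_eq.1 h).trans (sameBlock_iff_part_eq.1 h'))

theorem SameBlock.symm {P : Finpartition (Finset.univ : Finset (Fin N))} {i j : Fin N}
    (h : SameBlock P i j) : SameBlock P j i :=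
  sameBlock_iff_part_eq.2 (sameBlock_iff_part_eq.1 h).symm

theorem Finpartition.eq_of_sameBlock_iff {P Q : Finpartition (Finset.univ : Finset (Fin N))}
    (h : ∀ i j, SameBlock P i j ↔ SameBlock Q i j) : P = Q := by
  have key : ∀ {P Q : Finpartition (Finset.univ : Finset (Fin N))},
      (∀ i j, SameBlock P i j ↔ SameBlock Q i j) → ∀ p ∈ P.parts, p ∈ Q.parts := by
    intro P Q h p hp
    obtain ⟨a, ha⟩ := P.nonempty_of_mem_parts hp
    have e : Q.part a = p := by
      rw [← P.part_eq_of_mem hp ha]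
      ext i
      rw [← sameBlock_iff_mem_part, ← sameBlock_iff_mem_part, h]
    exact e ▸ Q.part_mem.2 (Finset.mem_univ a)
  exact Finpartition.ext (Finset.Subset.antisymm (key h) (key fun i j => (h i j).symm))

theorem sameBlock_iff_reflTransGen {P : Finpartition (Finset.univ : Finset (Fin N))}
    {i j : Fin N} (hij : i ≤ j) :
    SameBlock P i j ↔ Relation.ReflTransGen (IsArc P) i j := by
  constructor
  · intro h
    induction hd : (j : ℕ) - i using Nat.strong_induction_on generalizing i with
    | _ d ih =>
      rcases hij.eq_or_lt with rfl | hlt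
      · exact .refl
      · classical
        let s := Finset.univ.filter fun l => i < l ∧ SameBlock P i l
        have hs : s.Nonempty := ⟨j, by simp [s, hlt, h]⟩
        obtain ⟨-, hl1, hl2⟩ := Finset.mem_filter.1 (s.min'_mem hs)
        have hlj : s.min' hs ≤ j := s.min'_le j (by simp [s, hlt, h])
        refine .head ⟨hl1, hl2, fun l h1 h2 h3 => ?_⟩
          (ih _ ?_ hlj (hl2.symm.trans h) rfl)
        · exact (s.min'_le l (by simp [s, h1, h3])).not_gt h2
        · have h1 : (i : ℕ) < s.min' hs := hl1
          have h2 : ((s.min' hs : Fin N) : ℕ) ≤ j := hlj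
          omega
  · intro h
    induction h with
    | refl => exact sameBlock_iff_part_eq.2 rfl
    | tail h1 h2 ih =>
      rename_i b c
      by_cases hib : i ≤ b
      · exact (ih hib).trans h2.2.1
      · have : ∀ b, Relation.ReflTransGen (IsArc P) i b → i ≤ b := by
          intro b hb
          induction hb with
          | refl => exact le_rfl
          | tail _ h ih => exact ih.trans h.1.le
        exact absurd (this b h1) hib

theorem Finpartition.eq_of_isArc_iff {P Q : Finpartition (Finset.univ : Finset (Fin N))}
    (h : ∀ i j, IsArc P i j ↔ IsArc Q i j) : P = Q := by
  have e : IsArc P = IsArc Q := funext fun i => funext fun j => propext (h i j)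
  refine Finpartition.eq_of_sameBlock_iff fun i j => ?_
  rcases le_total i j with hij | hij
  · rw [sameBlock_iff_reflTransGen hij, sameBlock_iff_reflTransGen hij, e]
  · have := (sameBlock_iff_reflTransGen (P := P) hij).trans
      (e ▸ (sameBlock_iff_reflTransGen (P := Q) hij).symm)
    exact ⟨fun h => (this.1 h.symm).symm, fun h => (this.2 h.symm).symm⟩

/-- The arcs of a partition as a relation on the natural numbers. -/
def arcRel (P : Finpartition (Finset.univ : Finset (Fin N))) (i j : ℕ) : Prop :=
  ∃ (hi : i < N) (hj : j < N), IsArc P ⟨i, hi⟩ ⟨j, hj⟩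

theorem arcRel_val {P : Finpartition (Finset.univ : Finset (Fin N))} {i j : Fin N} :
    arcRel P i j ↔ IsArc P i j :=
  ⟨fun ⟨_, _, h⟩ => h, fun h => ⟨i.2, j.2, h⟩⟩

theorem arcSystem_arcRel (P : Finpartition (Finset.univ : Finset (Fin N))) :
    ArcSystem N (arcRel P) := by
  refine ⟨fun ⟨_, _, h⟩ => h.1, fun ⟨_, hj, _⟩ => hj, ?_, ?_⟩
  · rintro i j k ⟨hi, hj, h⟩ ⟨_, hk, h'⟩
    refine le_antisymm (not_lt.1 fun hlt => ?_) (not_lt.1 fun hlt => ?_)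
    · exact h.2.2 ⟨k, hk⟩ h'.1 hlt h'.2.1
    · exact h'.2.2 ⟨j, hj⟩ h.1 hlt h.2.1
  · rintro i j k ⟨hi, hk, h⟩ ⟨hj, _, h'⟩
    refine le_antisymm (not_lt.1 fun hlt => ?_) (not_lt.1 fun hlt => ?_)
    · exact h'.2.2 ⟨i, hi⟩ hlt h.1 (h'.2.1.trans h.2.1.symm)
    · exact h.2.2 ⟨j, hj⟩ hlt h'.1 (h.2.1.trans h'.2.1.symm)

theorem isKNoncrossingPartition_three_iff {P : Finpartition (Finset.univ : Finset (Fin N))} :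
    IsKNoncrossingPartition 3 P ↔ NoTripleCrossing (arcRel P) := by
  constructor
  · rintro h v₁ v₂ v₃ z₁ z₂ z₃ ⟨hv₁, hz₁, h₁⟩ ⟨hv₂, hz₂, h₂⟩ ⟨hv₃, hz₃, h₃⟩ h12 h23 h31 k12 k23
    refine h ⟨![⟨v₁, hv₁⟩, ⟨v₂, hv₂⟩, ⟨v₃, hv₃⟩], ![⟨z₁, hz₁⟩, ⟨z₂, hz₂⟩, ⟨z₃, hz₃⟩],
      ?_, ?_, ?_, ?_⟩
    · rw [Fin.strictMono_iff_lt_succ]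
      intro i
      fin_cases i <;> simpa
    · rw [Fin.strictMono_iff_lt_succ]
      intro i
      fin_cases i <;> simpa
    · intro m
      fin_cases m <;> simpa
    · intro m m'
      fin_cases m <;> fin_cases m' <;> simp <;> omega
  · rintro h ⟨a, b, ha, hb, hab, hlt⟩
    exact h (a 0) (a 1) (a 2) (b 0) (b 1) (b 2) (arcRel_val.2 (hab 0)) (arcRel_val.2 (hab 1))
      (arcRel_val.2 (hab 2)) (ha (by decide)) (ha (by decide)) (hlt 2 0) (hb (by decide))
      (hb (by decide))

theorem isTwoRegular_iff {P : Finpartition (Finset.univ : Finset (Fin N))} :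
    IsTwoRegular P ↔ ∀ i, ¬ arcRel P i (i + 1) := by
  constructor
  · rintro h i ⟨hi, hi', ha⟩
    have := h _ _ ha.2.1 (by simp)
    simp at this
  · intro h
    have key : ∀ i j : Fin N, SameBlock P i j → i < j → (i : ℕ) + 2 ≤ j := by
      intro i j hij hlt
      by_contra hc
      have hlt' : (i : ℕ) < j := hlt
      have hj : (j : ℕ) = i + 1 := by omega
      refine h i (hj ▸ arcRel_val.2 ⟨hlt, hij, fun l h1 h2 => ?_⟩)
      have h1' : (i : ℕ) < l := h1
      have h2' : (l : ℕ) < j := h2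
      omega
    intro i j hij hne
    rcases hne.lt_or_gt with hlt | hlt
    · have := key i j hij hlt
      rw [le_abs]
      omega
    · have := key j i hij.symm hlt
      rw [le_abs]
      omega

theorem ArcSystem.exists_partition {A : ℕ → ℕ → Prop} (hA : ArcSystem N A) :
    ∃ P : Finpartition (Finset.univ : Finset (Fin N)), arcRel P = A := by
  classical
  let r : Fin N → Fin N → Prop := fun i j => A i j
  have hle : ∀ {i j}, Relation.ReflTransGen r i j → i ≤ j := by
    intro i j h
    induction h with
    | refl => exact le_rfl
    | tail _ h ih => exact ih.trans (hA.lt h : _ < _).le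
  have hr : Relator.RightUnique r := fun i j k hj hk => Fin.ext (hA.right_unique hj hk)
  have hl : Relator.RightUnique (Function.swap r) :=
    fun i j k hj hk => Fin.ext (hA.left_unique hj hk)
  let s : Setoid (Fin N) :=
    { r := fun i j => Relation.ReflTransGen r i j ∨ Relation.ReflTransGen r j i
      iseqv := by
        refine ⟨fun i => .inl .refl, Or.symm, ?_⟩
        rintro i j k (hij | hij) (hjk | hjk)
        · exact .inl (hij.trans hjk)
        · have := Relation.ReflTransGen.total_of_right_unique hl
            (Relation.reflTransGen_swap.2 hij) (Relation.reflTransGen_swap.2 hjk)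
          exact (this.imp Relation.reflTransGen_swap.1 Relation.reflTransGen_swap.1).symm
        · exact Relation.ReflTransGen.total_of_right_unique hr hij hjk
        · exact .inr (hjk.trans hij) }
  let P := Finpartition.ofSetoid s
  have hP : ∀ i j, SameBlock P i j ↔
      Relation.ReflTransGen r i j ∨ Relation.ReflTransGen r j i := fun i j => by
    rw [sameBlock_iff_mem_part, Finpartition.mem_part_ofSetoid_iff_rel]
    exact or_comm
  have harc : ∀ i j, IsArc P i j ↔ r i j := by
    intro i j
    constructor
    · rintro ⟨hlt, hij, hmin⟩
      rcases ((hP i j).1 hij).resolve_right (fun h => (hle h).not_gt hlt) |>.cases_head with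
        rfl | ⟨k, hk, hkj⟩
      · exact absurd hlt (lt_irrefl _)
      · rcases (hle hkj).eq_or_lt with rfl | hlt'
        · exact hk
        · exact absurd ((hP i k).2 (.inl (.single hk))) (hmin k (hA.lt hk) hlt')
    · intro h
      refine ⟨hA.lt h, (hP i j).2 (.inl (.single h)), fun l h1 h2 h3 => ?_⟩
      rcases ((hP i l).1 h3).resolve_right (fun h => (hle h).not_gt h1) |>.cases_head with
        rfl | ⟨k, hk, hkl⟩
      · exact absurd h1 (lt_irrefl _)
      · obtain rfl := hr h hk
        exact (hle hkl).not_gt h2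
  refine ⟨P, funext fun i => funext fun j => propext ⟨?_, fun h => ?_⟩⟩
  · rintro ⟨hi, hj, h⟩
    exact (harc _ _).1 h
  · exact ⟨(hA.lt h).trans (hA.bound h), hA.bound h, (harc _ _).2 h⟩

end Partitions

/-- For `N ≥ 2`, the number of `2`-regular, `3`-noncrossing set partitions of `[N]`
equals `σ*^{1,0}_{2N-2}`, the number of `ℬ*_{W₂}`-walks of length `2N-2` ending
at `(1,0)`. -/
theorem two_regular_three_noncrossing_count (N : ℕ) (hN : 2 ≤ N) :
    Nat.card {P : Finpartition (Finset.univ : Finset (Fin N)) //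
        IsKNoncrossingPartition 3 P ∧ IsTwoRegular P}
      = sigmaStar (2 * N - 2) (1, 0) := by
  obtain ⟨M, rfl⟩ : ∃ M, N = M + 1 := ⟨N - 1, by omega⟩
  rw [show 2 * (M + 1) - 2 = 2 * M by omega, sigmaStar]
  have hex : ∀ P : {P : Finpartition (Finset.univ : Finset (Fin (M + 1))) //
      IsKNoncrossingPartition 3 P ∧ IsTwoRegular P}, ∃ SU : (ℕ → Tab) × (ℕ → Tab),
      Chain (arcRel P.1) SU.1 SU.2 := fun P => by
    obtain ⟨S, U, h⟩ := exists_chain (arcSystem_arcRel P.1)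
      (isKNoncrossingPartition_three_iff.1 P.2.1)
    exact ⟨(S, U), h⟩
  choose f hf using hex
  refine Nat.card_congr (Equiv.ofBijective (fun P => ⟨chainWalk (f P).1 (f P).2,
    (hf P).isBStarWalk (arcSystem_arcRel P.1) (isTwoRegular_iff.1 P.2.2)⟩) ⟨?_, ?_⟩)
  · intro P Q h
    have e := (hf P).arcs_unique (arcSystem_arcRel P.1) (arcSystem_arcRel Q.1) (hf Q)
      (Subtype.ext_iff.1 h)
    exact Subtype.ext (Finpartition.eq_of_isArc_iff fun i j => by
      rw [← arcRel_val, ← arcRel_val, e])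
  · rintro ⟨w, hw⟩
    obtain ⟨A, S, U, hA, hC, hreg, rfl⟩ := exists_chain_of_isBStarWalk hw
    obtain ⟨P, rfl⟩ := hA.exists_partition
    let P' : {P : Finpartition (Finset.univ : Finset (Fin (M + 1))) //
        IsKNoncrossingPartition 3 P ∧ IsTwoRegular P} :=
      ⟨P, isKNoncrossingPartition_three_iff.2 (hC.noTripleCrossing hA), isTwoRegular_iff.2 hreg⟩
    obtain ⟨e₁, e₂⟩ := (hf P').unique hA hC
    exact ⟨P', Subtype.ext (by simp only [e₁, e₂])⟩
end

section
/- For all integers k ≥ 3 and ℓ ≥ 0 and every point p ∈ W_{k−1}, the number of P_{W_{k−1}}-walks of length 2ℓ+1 ending at p equals the number of B_{W_{k−1}}-walks of length 2ℓ ending at p. -/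
/-- The Weyl chamber `W_d = {(a₁,…,a_d) ∈ ℤ^d : a₁ > a₂ > … > a_d ≥ 0}`. -/
def Wchamber (d : ℕ) : Set (Fin d → ℤ) :=
  {a | (∀ m n : Fin d, m < n → a n < a m) ∧ ∀ m, 0 ≤ a m}

/-- An "up" step in `ℤ^d`: `0` or a standard basis vector `e_h`. -/
def UpStepK {d : ℕ} (v : Fin d → ℤ) : Prop :=
  v = 0 ∨ ∃ h : Fin d, v = Pi.single h 1

/-- A "down" step in `ℤ^d`: `0` or `-e_h`. -/
def DownStepK {d : ℕ} (v : Fin d → ℤ) : Prop :=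
  v = 0 ∨ ∃ h : Fin d, v = Pi.single h (-1)

/-- The starting point `(d-1, d-2, …, 1, 0)` of the walks in `ℤ^d`. -/
def startK (d : ℕ) : Fin d → ℤ := fun m => (d : ℤ) - 1 - (m : ℤ)

/-- A `𝒫_{W_d}`-walk of length `s`: starts at `(d-1,…,1,0)`, stays in `W_d`,
odd steps are down steps, even steps are up steps. -/
def IsPWalkK (d s : ℕ) (w : ℕ → Fin d → ℤ) : Prop :=
  w 0 = startK d ∧ (∀ r ≤ s, w r ∈ Wchamber d) ∧
  (∀ r, 1 ≤ r → r ≤ s → r % 2 = 1 → DownStepK (w r - w (r - 1))) ∧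
  (∀ r, 1 ≤ r → r ≤ s → r % 2 = 0 → UpStepK (w r - w (r - 1))) ∧
  (∀ r, s ≤ r → w r = w s)

/-- A `ℬ_{W_d}`-walk of length `s`: starts at `(d-1,…,1,0)`, stays in `W_d`,
odd steps are up steps, even steps are down steps. -/
def IsBWalkK (d s : ℕ) (w : ℕ → Fin d → ℤ) : Prop :=
  w 0 = startK d ∧ (∀ r ≤ s, w r ∈ Wchamber d) ∧
  (∀ r, 1 ≤ r → r ≤ s → r % 2 = 1 → UpStepK (w r - w (r - 1))) ∧
  (∀ r, 1 ≤ r → r ≤ s → r % 2 = 0 → DownStepK (w r - w (r - 1))) ∧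
  (∀ r, s ≤ r → w r = w s)

/-- No nonzero down step from the starting point stays in the chamber. -/
theorem eq_startK_of_downStepK {d : ℕ} {a : Fin d → ℤ} (ha : a ∈ Wchamber d)
    (h : DownStepK (a - startK d)) : a = startK d := by
  rcases h with h | ⟨i, h⟩
  · exact sub_eq_zero.mp h
  · exfalso
    have hi : a i = startK d i - 1 := by
      have := congrFun h i
      simp only [Pi.sub_apply, Pi.single_eq_same] at this
      omega
    have hlt := i.isLt
    have hpos := ha.2 i
    simp only [startK] at hi
    by_cases hd : (i : ℕ) + 1 < d
    · have hne : (⟨i + 1, hd⟩ : Fin d) ≠ i := by simp [Fin.ext_iff]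
      have hj := congrFun h ⟨i + 1, hd⟩
      rw [Pi.single_eq_of_ne hne] at hj
      have hij := ha.1 i ⟨i + 1, hd⟩ (by simp [Fin.lt_def])
      simp only [Pi.sub_apply, startK] at hj
      push_cast at hj
      omega
    · omega

theorem IsPWalkK.apply_one {d s : ℕ} {w : ℕ → Fin d → ℤ} (hw : IsPWalkK d (s + 1) w) :
    w 1 = startK d := by
  refine eq_startK_of_downStepK (hw.2.1 1 (by omega)) ?_
  simpa [hw.1] using hw.2.2.1 1 le_rfl (by omega) rfl

theorem IsPWalkK.isBWalkK_tail {d s : ℕ} {w : ℕ → Fin d → ℤ} (hw : IsPWalkK d (s + 1) w) :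
    IsBWalkK d s (fun r => w (r + 1)) := by
  refine ⟨hw.apply_one, fun r hr => hw.2.1 _ (by omega), fun r h1 hr hp => ?_,
    fun r h1 hr hp => ?_, fun r hr => hw.2.2.2.2 _ (by omega)⟩
  · have := hw.2.2.2.1 (r + 1) (by omega) (by omega) (by omega)
    simpa [Nat.sub_add_cancel h1] using this
  · have := hw.2.2.1 (r + 1) (by omega) (by omega) (by omega)
    simpa [Nat.sub_add_cancel h1] using this

theorem IsBWalkK.isPWalkK_cons {d s : ℕ} {v : ℕ → Fin d → ℤ} (hv : IsBWalkK d s v) :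
    IsPWalkK d (s + 1) (fun r => v (r - 1)) := by
  refine ⟨hv.1, fun r hr => hv.2.1 _ (by omega), fun r h1 hr hp => ?_,
    fun r h1 hr hp => ?_, fun r hr => ?_⟩
  · rcases Nat.eq_or_lt_of_le h1 with rfl | h1
    · exact Or.inl (by simp)
    · exact hv.2.2.2.1 (r - 1) (by omega) (by omega) (by omega)
  · exact hv.2.2.1 (r - 1) (by omega) (by omega) (by omega)
  · simpa using hv.2.2.2.2 (r - 1) (by omega)

/-- Dropping the (forced) zero first step turns `𝒫`-walks into `ℬ`-walks, bijectively. -/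
def pWalkEquivBWalk (d s : ℕ) (p : Fin d → ℤ) :
    {w : ℕ → Fin d → ℤ // IsPWalkK d (s + 1) w ∧ w (s + 1) = p} ≃
      {v : ℕ → Fin d → ℤ // IsBWalkK d s v ∧ v s = p} where
  toFun w := ⟨fun r => w.1 (r + 1), w.2.1.isBWalkK_tail, w.2.2⟩
  invFun v := ⟨fun r => v.1 (r - 1), v.2.1.isPWalkK_cons, v.2.2⟩
  left_inv w := by
    ext1
    funext r
    rcases r with _ | r
    · exact w.2.1.apply_one.trans w.2.1.1.symm
    · rfl
  right_inv _ := rfl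

/-- For `k ≥ 3`, `ℓ ≥ 0` and `p ∈ W_{k-1}`, the number of `𝒫_{W_{k-1}}`-walks of
length `2ℓ+1` ending at `p` equals the number of `ℬ_{W_{k-1}}`-walks of length
`2ℓ` ending at `p`. -/
theorem pWalk_card_eq_bWalk_card (k ℓ : ℕ) (hk : 3 ≤ k)
    (p : Fin (k - 1) → ℤ) (hp : p ∈ Wchamber (k - 1)) :
    Nat.card {w : ℕ → Fin (k - 1) → ℤ // IsPWalkK (k - 1) (2 * ℓ + 1) w ∧ w (2 * ℓ + 1) = p}
      = Nat.card {w : ℕ → Fin (k - 1) → ℤ // IsBWalkK (k - 1) (2 * ℓ) w ∧ w (2 * ℓ) = p} := by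
  exact Nat.card_congr (pWalkEquivBWalk (k - 1) (2 * ℓ) p)
end
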